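/- arXiv:2203.07169 — 7 statements merged into one kernel-verified Lean document; each statement's English description precedes it below -/
import Mathlib

section
/- Let 𝔽_q be a finite field with q elements and let F ∈ 𝔽_q[x,y,z] be a homogeneous polynomial of degree δ ≥ 2 that is irreducible in 𝔽_q[x,y,z] (not necessarily geometrically irreducible). If q > ((1+√2)/2)^2 · δ² · (δ-1)² · (δ-2)², then there exists a nonzero linear form ℓ ∈ 𝔽_q[x,y,z] such that for every nonzero vector v ∈ 𝔽_q³ with ℓ(v) = 0 one has F(v) ≠ 0; that is, there is an 𝔽_q-line in ℙ² containing no 𝔽_q-points of the curve {F = 0}. -/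
open MvPolynomial

open scoped LinearAlgebra.Projectivization in
/-- second moment of line intersections -/
theorem LA_comb {K : Type} [Field K] [Fintype K] (B : Finset (ℙ K (Fin 3 → K))) (d : ℕ)
    (h1 : ∀ c : ℙ K (Fin 3 → K), ∃ P ∈ B, Projectivization.orthogonal P c)
    (h2 : ∀ (c : ℙ K (Fin 3 → K)) (T : Finset (ℙ K (Fin 3 → K))), T ⊆ B →
      (∀ P ∈ T, Projectivization.orthogonal P c) → T.card ≤ d) :
    (B.card : ℤ) ^ 2 + d * ((Fintype.card K : ℤ) ^ 2 + Fintype.card K + 1) ≤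
      B.card * (1 + d * (Fintype.card K + 1)) := by
  classical
  let Q := ℙ K (Fin 3 → K)
  have : Finite Q := (Projectivization.finite_iff_of_finite K (Fin 3 → K)).2 inferInstance
  have : Fintype Q := Fintype.ofFinite Q
  have hcard : Fintype.card Q = Fintype.card K ^ 2 + Fintype.card K + 1 := by
    have := Projectivization.card_of_finrank K (Fin 3 → K) (n := 3) (by simp)
    rw [← Nat.card_eq_fintype_card, this]
    simp [Finset.sum_range_succ]; ring
  have horder : Configuration.ProjectivePlane.order Q Q = Fintype.card K := by
    have h := Configuration.ProjectivePlane.card_points Q Q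
    rw [hcard] at h
    nlinarith
  set q : ℤ := (Fintype.card K : ℤ) with hq
  let I : Q → Q → Prop := fun P c => Projectivization.orthogonal P c
  let n : Q → ℤ := fun c => ((B.filter (fun P => I P c)).card : ℤ)
  have hn1 : ∀ c, 1 ≤ n c := by
    intro c
    obtain ⟨P, hP, hc⟩ := h1 c
    have : 0 < (B.filter (fun P => I P c)).card := Finset.card_pos.2 ⟨P, Finset.mem_filter.2 ⟨hP, hc⟩⟩
    show (1:ℤ) ≤ ((B.filter (fun P => I P c)).card : ℤ)
    exact_mod_cast this
  have hn2 : ∀ c, n c ≤ d := by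
    intro c
    have := h2 c (B.filter (fun P => I P c)) (Finset.filter_subset _ _)
      (fun P hP => (Finset.mem_filter.1 hP).2)
    show ((B.filter (fun P => I P c)).card : ℤ) ≤ d
    exact_mod_cast this
  have hn : ∀ c, n c = ∑ P ∈ B, if I P c then (1:ℤ) else 0 := by
    intro c
    rw [Finset.sum_boole]
  have hline : ∀ P : Q, (∑ c : Q, if I P c then (1:ℤ) else 0) = q + 1 := by
    intro P
    have h := Configuration.ProjectivePlane.lineCount_eq (P := Q) (L := Q) P
    rw [horder, Configuration.lineCount, Nat.card_eq_fintype_card, Fintype.card_subtype] at h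
    rw [Finset.sum_boole, hq]
    have h' : (Finset.univ.filter (fun c => I P c)).card = Fintype.card K + 1 := by
      rw [← h]; rfl
    exact_mod_cast h'
  have hpair : ∀ P R : Q, P ≠ R → (∑ c : Q, (if I P c then (1:ℤ) else 0) * (if I R c then (1:ℤ) else 0)) = 1 := by
    intro P R hPR
    obtain ⟨c, ⟨hc1, hc2⟩, huniq⟩ := Configuration.HasLines.existsUnique_line Q Q P R hPR
    rw [Finset.sum_eq_single c]
    · have e1 : I P c := hc1
      have e2 : I R c := hc2
      simp [e1, e2]
    · intro c' _ hne
      by_contra hh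
      apply hne
      apply huniq
      by_cases e1 : I P c' <;> by_cases e2 : I R c' <;> simp [e1, e2] at hh
      exact ⟨e1, e2⟩
    · simp
  have hs1 : ∑ c, n c = B.card * (q + 1) := by
    simp_rw [hn]
    rw [Finset.sum_comm]
    simp [hline]
  have hs2 : ∑ c, n c * n c = B.card * (q + 1) + B.card * (B.card - 1) := by
    simp_rw [hn, Finset.sum_mul_sum]
    rw [Finset.sum_comm]
    have : ∀ P ∈ B, ∑ c : Q, ∑ R ∈ B, (if I P c then (1:ℤ) else 0) * (if I R c then (1:ℤ) else 0)
        = (q + 1) + (B.card - 1) := by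
      intro P hP
      rw [Finset.sum_comm, ← Finset.add_sum_erase _ _ hP]
      congr 1
      · rw [← hline P]
        refine Finset.sum_congr rfl fun c _ => ?_
        split_ifs <;> simp
      · rw [Finset.sum_congr rfl (fun R hR => hpair P R (Finset.ne_of_mem_erase hR).symm)]
        simp [Finset.card_erase_of_mem hP]
        rw [Nat.cast_sub (Finset.card_pos.2 ⟨P, hP⟩)]; simp
    rw [Finset.sum_congr rfl this]
    simp; ring
  have hfin : ∑ c, (n c - 1) * (d - n c) ≥ 0 :=
    Finset.sum_nonneg fun c _ => mul_nonneg (by linarith [hn1 c]) (by linarith [hn2 c])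
  have hexp : ∑ c, (n c - 1) * (d - n c) = (d + 1) * ∑ c, n c - ∑ c, n c * n c - d * (Fintype.card Q : ℤ) := by
    rw [Finset.mul_sum, ← Finset.sum_sub_distrib]
    have : (d : ℤ) * (Fintype.card Q : ℤ) = ∑ c : Q, (d:ℤ) := by simp [mul_comm]
    rw [this, ← Finset.sum_sub_distrib]
    refine Finset.sum_congr rfl fun c _ => by ring
  rw [hexp, hs1, hs2, hcard] at hfin
  push_cast at hfin
  nlinarith

theorem LA_fin {K : Type} [Field K] (n : ℕ) : Module.Finite K (homogeneousSubmodule (Fin 3) K n) := by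
  exact Module.Finite.iff_fg.2 (homogeneousSubmodule_fg (σ := Fin 3) (R := K) n)

theorem LA_finrank {K : Type} [Field K] (n : ℕ) :
    Module.finrank K (homogeneousSubmodule (Fin 3) K n) = (n + 2).choose 2 := by
  classical
  rw [homogeneousSubmodule_eq_finsupp_supported]
  have e := AddMonoidAlgebra.supportedEquivFinsupp (S := K) (R := K) {d : Fin 3 →₀ ℕ | d.degree = n}
  have hs : {d : Fin 3 →₀ ℕ | d.degree = n} = ((Finset.univ : Finset (Fin 3)).finsuppAntidiag n : Set (Fin 3 →₀ ℕ)) := by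
    ext d
    simp [Finset.mem_finsuppAntidiag, Finsupp.degree_eq_sum]
  rw [LinearEquiv.finrank_eq e, hs, Module.finrank_finsupp_self]
  simp only [Finset.coe_sort_coe, Fintype.card_coe]
  rw [Finset.card_finsuppAntidiag_nat_eq_choose]
  simp
  rw [show n + 2 = 3 + n - 1 by omega]
  have := Nat.choose_symm (n := 3 + n - 1) (k := 2) (by omega)
  rw [← this]; congr 1; all_goals omega

theorem LA_finrank2 {K : Type} [Field K] (n : ℕ) :
    2 * (Module.finrank K (homogeneousSubmodule (Fin 3) K n) : ℤ) = (n + 2) * (n + 1) := by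
  rw [LA_finrank]
  have := Nat.choose_two_right (n + 2)
  have h2 : 2 ∣ (n + 2) * (n + 2 - 1) := by
    have := Nat.even_mul_pred_self (n+2)
    exact this.two_dvd
  have h3 : 2 * (n + 2).choose 2 = (n + 2) * (n + 1) := by
    rw [this]; rw [Nat.mul_div_cancel' h2]; rfl
  exact_mod_cast h3

/-- quotient of homogeneous by homogeneous is homogeneous -/
theorem LA_hom_div {K : Type} [Field K] {F h : MvPolynomial (Fin 3) K} {d r : ℕ}
    (hF : F.IsHomogeneous d) (hh : h.IsHomogeneous (r + d)) (hd : F ∣ h) :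
    ∃ g : MvPolynomial (Fin 3) K, g.IsHomogeneous r ∧ h = F * g := by
  obtain ⟨g, rfl⟩ := hd
  refine ⟨homogeneousComponent r g, homogeneousComponent_isHomogeneous _ _, ?_⟩
  have h1 : F * g = homogeneousComponent (r + d) (F * g) := (homogeneousComponent_eq_self hh).symm
  rw [h1]
  conv_lhs => rw [← sum_homogeneousComponent g, Finset.mul_sum, map_sum]
  have h2 : ∀ i, homogeneousComponent (r + d) (F * homogeneousComponent i g)
      = if i = r then F * homogeneousComponent r g else 0 := by
    intro i
    have := hF.mul (homogeneousComponent_isHomogeneous i g)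
    rw [homogeneousComponent_of_mem this]
    by_cases hi : i = r
    · subst hi; simp [add_comm]
    · rw [if_neg, if_neg hi]; omega
  simp_rw [h2]
  rw [Finset.sum_ite_eq']
  split_ifs with h3
  · rfl
  · rw [homogeneousComponent_eq_zero, mul_zero]
    simpa using h3

theorem LA_codim {K V T : Type} [Field K] [AddCommGroup V] [Module K V] [Module.Finite K V]
    [Fintype T] (W : Submodule K V) (L : T → V →ₗ[K] K) (h0 : ∀ t, ∀ w ∈ W, L t w = 0)
    (hind : ∀ c : T → K, (∀ v, ∑ t, c t * L t v = 0) → c = 0) :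
    Fintype.card T + Module.finrank K W ≤ Module.finrank K V := by
  let Λ : V →ₗ[K] (T → K) := LinearMap.pi L
  have hsurj : LinearMap.range Λ = ⊤ := by
    by_contra hne
    obtain ⟨f, hf, hf2⟩ := Submodule.exists_dual_map_eq_bot_of_lt_top (lt_top_iff_ne_top.2 hne) inferInstance
    apply hf
    classical
    have hc : (fun t => f (Pi.single t 1)) = 0 := by
      apply hind
      intro v
      have h1 : f (Λ v) = 0 := by
        have : f (Λ v) ∈ (LinearMap.range Λ).map f := ⟨_, ⟨v, rfl⟩, rfl⟩
        rw [hf2] at this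
        exact (Submodule.mem_bot K).1 this
      rw [← h1]
      conv_rhs => rw [← Finset.univ_sum_single (Λ v), map_sum]
      refine Finset.sum_congr rfl fun t _ => ?_
      have : (Pi.single t (Λ v t) : T → K) = (Λ v t) • Pi.single t 1 := by
        rw [← Pi.single_smul]; simp
      rw [this, map_smul, smul_eq_mul, mul_comm]
      rfl
    apply LinearMap.pi_ext'
    intro t
    ext
    simpa using congrFun hc t
  have h1 := LinearMap.finrank_range_add_finrank_ker Λ
  rw [hsurj, finrank_top, Module.finrank_fintype_fun_eq_card] at h1
  have h2 : W ≤ LinearMap.ker Λ := by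
    intro w hw
    rw [LinearMap.mem_ker]
    ext t
    exact h0 t w hw
  have := Submodule.finrank_mono h2
  omega

/-- abstract Bezout by dimension count -/
theorem LA_bezout {K : Type} [Field K] {F G : MvPolynomial (Fin 3) K} {d r : ℕ}
    (hF : F.IsHomogeneous d) (hG : G.IsHomogeneous r) (hFp : Prime F) (hnd : ¬ F ∣ G)
    {T : Type} [Fintype T] (Λ : T → MvPolynomial (Fin 3) K →ₗ[K] K) (a : ℕ)
    (hΛF : ∀ t h, Λ t (F * h) = 0) (hΛG : ∀ t h, Λ t (G * h) = 0)
    (hind : ∀ n, a ≤ n → ∀ c : T → K,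
      (∀ w : MvPolynomial (Fin 3) K, w.IsHomogeneous n → ∑ t, c t * Λ t w = 0) → c = 0) :
    Fintype.card T ≤ r * d := by
  classical
  have fin : ∀ n, Module.Finite K (homogeneousSubmodule (Fin 3) K n) := LA_fin
  let V := fun n => homogeneousSubmodule (Fin 3) K n
  let n := a + d + r
  let mulL : MvPolynomial (Fin 3) K → MvPolynomial (Fin 3) K →ₗ[K] MvPolynomial (Fin 3) K :=
    fun f => LinearMap.mulLeft K f
  let Φ₀ : (V (a + r) × V (a + d)) →ₗ[K] MvPolynomial (Fin 3) K :=
    ((mulL F).comp (V (a + r)).subtype).coprod ((mulL G).comp (V (a + d)).subtype)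
  have hΦ₀ : ∀ x, Φ₀ x = F * x.1.1 + G * x.2.1 := fun x => by simp [Φ₀, mulL]
  let Φ : (V (a + r) × V (a + d)) →ₗ[K] V n := Φ₀.codRestrict (V n) (by
    rintro ⟨⟨h1, h1'⟩, ⟨h2, h2'⟩⟩
    rw [hΦ₀]
    have e1 : (F * h1).IsHomogeneous n := by
      have := hF.mul ((mem_homogeneousSubmodule _ _).1 h1')
      rwa [show d + (a + r) = n by simp only [n]; omega] at this
    have e2 : (G * h2).IsHomogeneous n := by
      have := hG.mul ((mem_homogeneousSubmodule _ _).1 h2')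
      rwa [show r + (a + d) = n by simp only [n]; omega] at this
    exact e1.add e2)
  have hΦ : ∀ x, (Φ x : MvPolynomial (Fin 3) K) = F * x.1.1 + G * x.2.1 := fun x => hΦ₀ x
  let Ψ₁ : V a →ₗ[K] V (a + r) := ((mulL G).comp (V a).subtype).codRestrict (V (a + r)) (by
    rintro ⟨h, hh⟩
    have := hG.mul ((mem_homogeneousSubmodule _ _).1 hh)
    rw [add_comm] at this
    exact this)
  let Ψ₂ : V a →ₗ[K] V (a + d) := (-((mulL F).comp (V a).subtype)).codRestrict (V (a + d)) (by
    rintro ⟨h, hh⟩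
    have := (hF.mul ((mem_homogeneousSubmodule _ _).1 hh)).neg
    rw [add_comm] at this
    exact this)
  have hker : LinearMap.ker Φ ≤ LinearMap.range (Ψ₁.prod Ψ₂) := by
    rintro ⟨⟨h1, h1'⟩, ⟨h2, h2'⟩⟩ hx
    rw [LinearMap.mem_ker] at hx
    have hx' : F * h1 + G * h2 = 0 := by
      have := hΦ (⟨h1, h1'⟩, ⟨h2, h2'⟩)
      rw [hx] at this
      exact this.symm
    have hdiv : F ∣ G * h2 := ⟨-h1, by linear_combination hx'⟩
    have hdiv2 : F ∣ h2 := (hFp.dvd_or_dvd hdiv).resolve_left hnd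
    obtain ⟨g, hg, rfl⟩ := LA_hom_div hF ((mem_homogeneousSubmodule _ _).1 h2') hdiv2
    refine ⟨-⟨g, hg⟩, ?_⟩
    have e1 : h1 = -(G * g) := by
      apply mul_left_cancel₀ hFp.ne_zero
      linear_combination hx'
    apply Prod.ext
    · apply Subtype.ext
      show G * (-g) = h1
      rw [e1]; ring
    · apply Subtype.ext
      show -(F * (-g)) = F * g
      ring
  have hk1 : Module.finrank K (LinearMap.ker Φ) ≤ Module.finrank K (V a) :=
    (Submodule.finrank_mono hker).trans (LinearMap.finrank_range_le _)
  have hrn := LinearMap.finrank_range_add_finrank_ker Φ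
  rw [Module.finrank_prod] at hrn
  have hT := LA_codim (LinearMap.range Φ) (fun t => (Λ t).comp (V n).subtype) (by
    rintro t _ ⟨x, rfl⟩
    show Λ t (Φ x : MvPolynomial (Fin 3) K) = 0
    rw [hΦ, map_add, hΛF, hΛG, add_zero]) (by
    intro c hc
    exact hind n (by simp only [n]; omega) c (fun w hw => hc ⟨w, hw⟩))
  have f1 := LA_finrank2 (K := K) a
  have f2 := LA_finrank2 (K := K) (a + r)
  have f3 := LA_finrank2 (K := K) (a + d)
  have f4 := LA_finrank2 (K := K) n
  simp only [n] at f4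
  push_cast at f1 f2 f3 f4
  have hT' : (Fintype.card T : ℤ) + Module.finrank K (LinearMap.range Φ) ≤ Module.finrank K (V n) := by
    exact_mod_cast hT
  have hk1' : (Module.finrank K (LinearMap.ker Φ) : ℤ) ≤ Module.finrank K (V a) := by exact_mod_cast hk1
  have hrn' : (Module.finrank K (LinearMap.range Φ) : ℤ) + Module.finrank K (LinearMap.ker Φ) =
    Module.finrank K (V (a + r)) + Module.finrank K (V (a + d)) := by exact_mod_cast hrn
  have : (Fintype.card T : ℤ) ≤ r * d := by
    simp only [V, n] at *
    nlinarith
  exact_mod_cast this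

section LApoints
variable {K : Type} [Field K] (D : Derivation K (MvPolynomial (Fin 3) K) (MvPolynomial (Fin 3) K))

/-- vanishing to order `e` along the derivation -/
def LAvan (v : Fin 3 → K) (e : ℕ) (w : MvPolynomial (Fin 3) K) : Prop :=
  ∀ k < e, eval v (((D : MvPolynomial (Fin 3) K →ₗ[K] MvPolynomial (Fin 3) K) ^ k) w) = 0

theorem LAvan_mono {v : Fin 3 → K} {e e' : ℕ} (h : e' ≤ e) {w : MvPolynomial (Fin 3) K}
    (hw : LAvan D v e w) : LAvan D v e' w := fun k hk => hw k (by omega)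

theorem LAvan_add {v : Fin 3 → K} {e : ℕ} {w u : MvPolynomial (Fin 3) K}
    (hw : LAvan D v e w) (hu : LAvan D v e u) : LAvan D v e (w + u) := fun k hk => by
  rw [map_add, map_add, hw k hk, hu k hk, add_zero]

theorem LAvan_succ {v : Fin 3 → K} {e : ℕ} {w : MvPolynomial (Fin 3) K} :
    LAvan D v (e + 1) w ↔ eval v w = 0 ∧ LAvan D v e (D w) := by
  constructor
  · intro h
    refine ⟨by simpa using h 0 (by omega), fun k hk => ?_⟩
    have := h (k + 1) (by omega)
    rwa [pow_succ] at this
  · rintro ⟨h1, h2⟩ k hk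
    rcases k with _ | k
    · simpa using h1
    · rw [pow_succ]
      exact h2 k (by omega)

theorem LAvan_mul {v : Fin 3 → K} {e : ℕ} : ∀ {w : MvPolynomial (Fin 3) K}
    (h : MvPolynomial (Fin 3) K), LAvan D v e w → LAvan D v e (w * h) := by
  induction e with
  | zero => intro w h _ k hk; omega
  | succ e ih =>
    intro w h hw
    have hw' := (LAvan_succ D).1 hw
    rw [LAvan_succ]
    refine ⟨by simp [hw'.1], ?_⟩
    rw [Derivation.leibniz, smul_eq_mul, smul_eq_mul]
    refine LAvan_add D (ih _ (LAvan_mono D (by omega) hw)) ?_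
    rw [mul_comm]
    exact ih _ hw'.2

theorem LAvan_pow {v : Fin 3 → K} {τ : MvPolynomial (Fin 3) K} (hτ : eval v τ = 0) :
    ∀ j, LAvan D v j (τ ^ j) := by
  intro j
  induction j with
  | zero => intro k hk; omega
  | succ j ih =>
    rw [LAvan_succ]
    refine ⟨by simp [hτ], ?_⟩
    rw [Derivation.leibniz_pow, Nat.add_sub_cancel]
    have := LAvan_mul D (((j + 1 : ℕ) : MvPolynomial (Fin 3) K) * D τ) ih
    convert this using 1
    simp only [nsmul_eq_mul, smul_eq_mul]
    ring

theorem LAvan_lead {v : Fin 3 → K} {τ : MvPolynomial (Fin 3) K} (hτ : eval v τ = 0) :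
    ∀ (j : ℕ) (h : MvPolynomial (Fin 3) K),
    eval v (((D : MvPolynomial (Fin 3) K →ₗ[K] MvPolynomial (Fin 3) K) ^ j) (τ ^ j * h)) =
      (j.factorial : K) * (eval v (D τ)) ^ j * eval v h := by
  intro j
  induction j with
  | zero => intro h; simp
  | succ j ih =>
    intro h
    rw [pow_succ (D : MvPolynomial (Fin 3) K →ₗ[K] MvPolynomial (Fin 3) K)]
    have e1 : D (τ ^ (j + 1) * h) = τ ^ (j + 1) * D h +
        τ ^ j * (((j + 1 : ℕ) : MvPolynomial (Fin 3) K) * D τ * h) := by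
      rw [Derivation.leibniz, Derivation.leibniz_pow, Nat.add_sub_cancel]
      simp only [nsmul_eq_mul, smul_eq_mul]
      ring
    show eval v (((D : MvPolynomial (Fin 3) K →ₗ[K] MvPolynomial (Fin 3) K) ^ j)
      (D (τ ^ (j + 1) * h))) = _
    rw [e1, map_add, map_add, ih, LAvan_mul D (D h) (LAvan_pow D hτ (j + 1)) j (by omega)]
    rw [Nat.factorial_succ]
    simp
    ring

open scoped LinearAlgebra.Projectivization in
theorem LA_sep {P Q : ℙ K (Fin 3 → K)} (h : P ≠ Q) : ∃ l : MvPolynomial (Fin 3) K,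
    l.IsHomogeneous 1 ∧ eval Q.rep l = 0 ∧ eval P.rep l ≠ 0 := by
  have h1 : P.rep ∉ Submodule.span K {Q.rep} := by
    intro hm
    rw [Submodule.mem_span_singleton] at hm
    obtain ⟨a, ha⟩ := hm
    apply h
    have hne : a ≠ 0 := by
      rintro rfl
      exact P.rep_nonzero (by simpa using ha.symm)
    rw [← P.mk_rep, ← Q.mk_rep, Projectivization.mk_eq_mk_iff]
    exact ⟨Units.mk0 a hne, ha⟩
  obtain ⟨f, hf, hf2⟩ := Submodule.exists_dual_map_eq_bot_of_notMem h1 inferInstance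
  have hev : ∀ v : Fin 3 → K, eval v (∑ i, C (f (Pi.single i 1)) * X i) = f v := by
    intro v
    conv_rhs => rw [← Finset.univ_sum_single v, map_sum]
    simp only [map_sum, map_mul, eval_C, eval_X]
    refine Finset.sum_congr rfl fun t _ => ?_
    have : (Pi.single t (v t) : Fin 3 → K) = (v t) • Pi.single t 1 := by
      rw [← Pi.single_smul]; simp
    rw [this, map_smul, smul_eq_mul, mul_comm]
  refine ⟨∑ i, C (f (Pi.single i 1)) * X i, ?_, ?_, ?_⟩
  · exact IsHomogeneous.sum _ _ _ fun i _ => isHomogeneous_C_mul_X _ _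
  · rw [hev]
    have : f Q.rep ∈ (Submodule.span K {Q.rep}).map f :=
      ⟨_, Submodule.mem_span_singleton_self _, rfl⟩
    rw [hf2] at this
    exact (Submodule.mem_bot K).1 this
  · rwa [hev]

theorem LA_nonvan {v : Fin 3 → K} (hv : v ≠ 0) : ∃ l : MvPolynomial (Fin 3) K,
    l.IsHomogeneous 1 ∧ eval v l ≠ 0 := by
  obtain ⟨i, hi⟩ := Function.ne_iff.1 hv
  exact ⟨X i, isHomogeneous_X _ _, by simpa using hi⟩

open scoped LinearAlgebra.Projectivization in
/-- Bezout with multiplicities -/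
theorem LA_points {F G : MvPolynomial (Fin 3) K} {d r : ℕ}
    (hF : F.IsHomogeneous d) (hG : G.IsHomogeneous r) (hFp : Prime F) (hnd : ¬ F ∣ G)
    (hDF : D F = 0) (e : ℕ) (he : ∀ j < e, (j.factorial : K) ≠ 0)
    (T : Finset (ℙ K (Fin 3 → K))) (hTF : ∀ P ∈ T, eval P.rep F = 0)
    (hTG : ∀ P ∈ T, LAvan D P.rep e G)
    (hsm : 1 < e → ∀ P ∈ T, ∃ τ : MvPolynomial (Fin 3) K, τ.IsHomogeneous 1 ∧ eval P.rep τ = 0 ∧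
      eval P.rep (D τ) ≠ 0) :
    e * T.card ≤ r * d := by
  classical
  let Λ : (T × Fin e) → MvPolynomial (Fin 3) K →ₗ[K] K := fun t =>
    (aeval (R := K) t.1.1.rep).toLinearMap.comp
      ((D : MvPolynomial (Fin 3) K →ₗ[K] MvPolynomial (Fin 3) K) ^ (t.2 : ℕ))
  have hΛ : ∀ t w, Λ t w = eval t.1.1.rep
      (((D : MvPolynomial (Fin 3) K →ₗ[K] MvPolynomial (Fin 3) K) ^ (t.2 : ℕ)) w) := by
    intro t w
    simp [Λ, aeval_eq_eval]
  have hFvan : ∀ P ∈ T, LAvan D P.rep e F := by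
    intro P hP k hk
    rcases k with _ | k
    · simpa using hTF P hP
    · rw [pow_succ]
      show eval _ (((D : MvPolynomial (Fin 3) K →ₗ[K] MvPolynomial (Fin 3) K) ^ k) (D F)) = 0
      rw [hDF]; simp
  have hmain := LA_bezout hF hG hFp hnd Λ (e + T.card * e) (by
      intro t h
      rw [hΛ]
      exact LAvan_mul D h (hFvan _ t.1.2) _ t.2.2) (by
      intro t h
      rw [hΛ]
      exact LAvan_mul D h (hTG _ t.1.2) _ t.2.2) (by
    intro n hn c hc
    -- test polynomials
    have htest : ∀ (P : T) (j : Fin e), ∃ w : MvPolynomial (Fin 3) K, w.IsHomogeneous n ∧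
        (∀ Q : T, Q ≠ P → ∀ k, Λ (Q, k) w = 0) ∧ (∀ k, k < j → Λ (P, k) w = 0) ∧
        Λ (P, j) w ≠ 0 := by
      intro P j
      obtain ⟨h0, hh0, hh0'⟩ := LA_nonvan P.1.rep_nonzero
      have hτ : ∃ τ : MvPolynomial (Fin 3) K, τ.IsHomogeneous 1 ∧ eval P.1.rep τ = 0 ∧
          ((j : ℕ) ≠ 0 → eval P.1.rep (D τ) ≠ 0) := by
        by_cases h1 : 1 < e
        · obtain ⟨τ, a1, a2, a3⟩ := hsm h1 P.1 P.2
          exact ⟨τ, a1, a2, fun _ => a3⟩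
        · exact ⟨0, isHomogeneous_zero _ _ _, by simp, fun h => by have := j.2; omega⟩
      obtain ⟨τ, hτ1, hτ2, hτ3⟩ := hτ
      have hsep : ∀ Q : T, ∃ l : MvPolynomial (Fin 3) K, l.IsHomogeneous 1 ∧
          (Q ≠ P → eval Q.1.rep l = 0) ∧ eval P.1.rep l ≠ 0 := by
        intro Q
        by_cases hQ : Q = P
        · exact ⟨h0, hh0, fun h => (h hQ).elim, hh0'⟩
        · obtain ⟨l, a1, a2, a3⟩ := LA_sep (P := P.1) (Q := Q.1) (fun h => hQ (Subtype.ext h.symm))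
          exact ⟨l, a1, fun _ => a2, a3⟩
      choose l hl1 hl2 hl3 using hsep
      let R : MvPolynomial (Fin 3) K := (∏ Q : T, l Q ^ e) * h0 ^ (n - j - T.card * e)
      have hRe : eval P.1.rep R ≠ 0 := by
        simp only [R, map_mul, map_prod, map_pow]
        exact mul_ne_zero (Finset.prod_ne_zero_iff.2 fun Q _ => pow_ne_zero _ (hl3 Q))
          (pow_ne_zero _ hh0')
      refine ⟨τ ^ (j : ℕ) * R, ?_, ?_, ?_, ?_⟩
      · have a1 := hτ1.pow (j : ℕ)
        have a2 : (∏ Q : T, l Q ^ e).IsHomogeneous (∑ Q : T, e) :=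
          IsHomogeneous.prod _ _ _ fun Q _ => by simpa using (hl1 Q).pow e
        have a3 := hh0.pow (n - j - T.card * e)
        have a4 := a1.mul (a2.mul a3)
        convert a4 using 1
        have := j.2
        simp only [Finset.sum_const, Finset.card_univ, Fintype.card_coe, smul_eq_mul]
        omega
      · intro Q hQ k
        rw [hΛ]
        have : τ ^ (j : ℕ) * R = l Q ^ e * (τ ^ (j : ℕ) * ((∏ Q' ∈ Finset.univ.erase Q, l Q' ^ e) *
            h0 ^ (n - j - T.card * e))) := by
          simp only [R]
          rw [← Finset.mul_prod_erase _ _ (Finset.mem_univ Q)]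
          ring
        rw [this]
        exact LAvan_mul D _ (LAvan_pow D (hl2 Q hQ) e) _ k.2
      · intro k hk
        rw [hΛ]
        exact LAvan_mul D _ (LAvan_pow D hτ2 j) _ hk
      · rw [hΛ]
        show eval P.1.rep (((D : MvPolynomial (Fin 3) K →ₗ[K] MvPolynomial (Fin 3) K) ^ (j : ℕ))
          (τ ^ (j : ℕ) * R)) ≠ 0
        rw [LAvan_lead D hτ2]
        refine mul_ne_zero (mul_ne_zero (he _ j.2) ?_) hRe
        by_cases hj : (j : ℕ) = 0
        · rw [hj]; simp
        · exact pow_ne_zero _ (hτ3 hj)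
    have hind : ∀ (P : T) (i : ℕ) (j : Fin e), e - j ≤ i → c (P, j) = 0 := by
      intro P i
      induction i with
      | zero => intro j hj; have := j.2; omega
      | succ i ih =>
        intro j hj
        obtain ⟨w, hw, h1, h2, h3⟩ := htest P j
        have hs := hc w hw
        rw [Finset.sum_eq_single (P, j)] at hs
        · exact (mul_eq_zero.1 hs).resolve_right h3
        · rintro ⟨Q, k⟩ - hne
          by_cases hQ : Q = P
          · subst hQ
            rcases lt_trichotomy k j with hk | hk | hk
            · rw [h2 k hk, mul_zero]
            · subst hk; exact (hne rfl).elim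
            · rw [ih k (by have := k.2; have : (j : ℕ) < k := hk; omega), zero_mul]
          · rw [h1 Q hQ k, mul_zero]
        · simp
    funext ⟨P, j⟩
    exact hind P _ j le_rfl)
  rw [Fintype.card_prod, Fintype.card_coe, Fintype.card_fin] at hmain
  rwa [mul_comm]

end LApoints

open Polynomial in
theorem LA_hensel {R : Type} [CommRing R] (I : Ideal R) [IsAdicComplete I R] (f : R[X]) (a₀ : R)
    (h₁ : f.eval a₀ ∈ I) (h₂ : IsUnit (Ideal.Quotient.mk I (f.derivative.eval a₀))) :
    ∃ a : R, f.IsRoot a := by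
  classical
    let f' := derivative f
    let c : ℕ → R := fun n => Nat.recOn n a₀ fun _ b => b - f.eval b * Ring.inverse (f'.eval b)
    have hc : ∀ n, c (n + 1) = c n - f.eval (c n) * Ring.inverse (f'.eval (c n)) := by
      intro n
      simp only [c]
    have hc_mod : ∀ n, c n ≡ a₀ [SMOD I] := by
      intro n
      induction n with
      | zero => rfl
      | succ n ih => ?_
      rw [hc, sub_eq_add_neg, ← add_zero a₀]
      refine ih.add ?_
      rw [SModEq.zero, Ideal.neg_mem_iff]
      refine I.mul_mem_right _ ?_
      rw [← SModEq.zero] at h₁ ⊢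
      exact (ih.eval f).trans h₁
    have hfprc : ∀ n, IsUnit (f'.eval (c n)) := by
      intro n
      have := isLocalHom_of_le_jacobson_bot I (IsAdicComplete.le_jacobson_bot I)
      apply IsUnit.of_map (Ideal.Quotient.mk I)
      convert! h₂ using 1
      exact SModEq.def.mp ((hc_mod n).eval _)
    have hfcI : ∀ n, f.eval (c n) ∈ I ^ (n + 1) := by
      intro n
      induction n with
      | zero => simpa only [Nat.rec_zero, zero_add, pow_one] using! h₁
      | succ n ih => ?_
      rw [← taylor_eval_sub (c n), hc, sub_eq_add_neg, sub_eq_add_neg,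
        add_neg_cancel_comm]
      rw [eval_eq_sum, sum_over_range' _ _ _ (lt_add_of_pos_right _ zero_lt_two), ←
        Finset.sum_range_add_sum_Ico _ (Nat.le_add_left _ _)]
      swap
      · intro i
        rw [zero_mul]
      refine Ideal.add_mem _ ?_ ?_
      · rw [← one_add_one_eq_two, Finset.sum_range_succ, Finset.range_one, Finset.sum_singleton,
          taylor_coeff_zero, taylor_coeff_one, pow_zero, pow_one, mul_one, mul_neg,
          mul_left_comm, Ring.mul_inverse_cancel _ (hfprc n), mul_one, add_neg_cancel]
        exact Ideal.zero_mem _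
      · refine Submodule.sum_mem _ ?_
        simp only [Finset.mem_Ico]
        rintro i ⟨h2i, _⟩
        have aux : n + 2 ≤ i * (n + 1) := by trans 2 * (n + 1) <;> nlinarith only [h2i]
        refine Ideal.mul_mem_left _ _ (Ideal.pow_le_pow_right aux ?_)
        rw [pow_mul']
        exact Ideal.pow_mem_pow ((Ideal.neg_mem_iff _).2 <| Ideal.mul_mem_right _ _ ih) _
    -- we are now in the position to show that `c : ℕ → R` is a Cauchy sequence
    have aux : ∀ m n, m ≤ n → c m ≡ c n [SMOD (I ^ m • ⊤ : Ideal R)] := by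
      intro m n hmn
      rw [← Ideal.one_eq_top, Ideal.smul_eq_mul, mul_one]
      obtain ⟨k, rfl⟩ := Nat.exists_eq_add_of_le hmn
      clear hmn
      induction k with
      | zero => rw [add_zero]
      | succ k ih => ?_
      rw [← add_assoc, hc, ← add_zero (c m), sub_eq_add_neg]
      refine ih.add ?_
      symm
      rw [SModEq.zero, Ideal.neg_mem_iff]
      refine Ideal.mul_mem_right _ _ (Ideal.pow_le_pow_right ?_ (hfcI _))
      rw [add_assoc]
      exact le_self_add
    -- hence the sequence converges to some limit point `a`, which is the `a` we are looking for
    obtain ⟨a, ha⟩ := IsPrecomplete.prec' c (aux _ _)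
    refine ⟨a, ?_⟩
    · show f.IsRoot a
      suffices ∀ n, f.eval a ≡ 0 [SMOD (I ^ n • ⊤ : Ideal R)] by exact IsHausdorff.haus' _ this
      intro n
      specialize ha n
      rw [← Ideal.one_eq_top, Ideal.smul_eq_mul, mul_one] at ha ⊢
      refine (ha.symm.eval f).trans ?_
      rw [SModEq.zero]
      exact Ideal.pow_le_pow_right le_self_add (hfcI _)

theorem LA_branch_aux {K : Type} [Field K] {F : MvPolynomial (Fin 3) K} (v : Fin 3 → K)
    (hv2 : v 2 ≠ 0) (hF : eval v F = 0) (i j : Fin 3) (hij : i ≠ j) (hi : i ≠ 2) (hj : j ≠ 2)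
    (hd : eval v (pderiv j F) ≠ 0) :
    ∃ φ : MvPolynomial (Fin 3) K →ₐ[K] PowerSeries K, φ F = 0 ∧
      φ (X i) = PowerSeries.C (v i) + PowerSeries.X ∧ φ (X 2) = PowerSeries.C (v 2) := by
  classical
  let g : Fin 3 → Polynomial (PowerSeries K) := fun k =>
    if k = j then Polynomial.X else if k = i then Polynomial.C (PowerSeries.C (v i) + PowerSeries.X)
      else Polynomial.C (PowerSeries.C (v k))
  let f : Polynomial (PowerSeries K) := aeval g F
  have hder : ∀ u : MvPolynomial (Fin 3) K, Polynomial.derivative (aeval g u) = aeval g (pderiv j u) := by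
    intro u
    induction u using MvPolynomial.induction_on with
    | C a =>
      rw [pderiv_C, map_zero]
      rw [show (C a : MvPolynomial (Fin 3) K) = algebraMap K _ a from rfl, AlgHom.commutes,
        IsScalarTower.algebraMap_apply K (PowerSeries K) (Polynomial (PowerSeries K))]
      exact Polynomial.derivative_C
    | add p q hp hq => simp only [map_add, hp, hq]
    | mul_X p k hp =>
      have hk : Polynomial.derivative (g k) = aeval g (pderiv j (X k : MvPolynomial (Fin 3) K)) := by
        rw [pderiv_X]
        by_cases h : k = j
        · subst h; simp [g]
        · simp only [g, if_neg h, Pi.single_eq_of_ne h]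
          split_ifs <;> simp
      rw [map_mul, aeval_X, Polynomial.derivative_mul, hp, Derivation.leibniz, map_add, smul_eq_mul,
        smul_eq_mul, map_mul, map_mul, aeval_X, hk]
      ring
  have hev : ∀ u : MvPolynomial (Fin 3) K,
      PowerSeries.constantCoeff ((aeval g u).eval (PowerSeries.C (v j))) = eval v u := by
    intro u
    induction u using MvPolynomial.induction_on with
    | C a =>
      rw [show (C a : MvPolynomial (Fin 3) K) = algebraMap K _ a from rfl, AlgHom.commutes,
        IsScalarTower.algebraMap_apply K (PowerSeries K) (Polynomial (PowerSeries K))]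
      rw [Polynomial.algebraMap_apply, Algebra.algebraMap_self, RingHom.id_apply, Polynomial.eval_C]
      simp [algebraMap_eq, PowerSeries.algebraMap_apply]
    | add p q hp hq => simp only [map_add, Polynomial.eval_add, hp, hq]
    | mul_X p k hp =>
      rw [map_mul, Polynomial.eval_mul, map_mul, hp, map_mul, aeval_X, eval_X]
      congr 1
      simp only [g]
      split_ifs with h1 h2
      · subst h1; simp
      · subst h2; simp
      · simp
  obtain ⟨a, ha⟩ := LA_hensel (Ideal.span {(PowerSeries.X : PowerSeries K)}) f (PowerSeries.C (v j))
    (by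
      rw [Ideal.mem_span_singleton, PowerSeries.X_dvd_iff, hev, hF])
    (by
      apply RingHom.isUnit_map
      rw [PowerSeries.isUnit_iff_constantCoeff, hder, hev]
      exact isUnit_iff_ne_zero.2 hd)
  let φ : MvPolynomial (Fin 3) K →ₐ[K] PowerSeries K :=
    ((Polynomial.aeval a : Polynomial (PowerSeries K) →ₐ[PowerSeries K] PowerSeries K).restrictScalars K).comp
      (aeval g)
  have hφ : ∀ u, φ u = (aeval g u).eval a := fun u => by
    simp [φ, Polynomial.aeval_def, Polynomial.eval₂_eq_eval_map]
  refine ⟨φ, ?_, ?_, ?_⟩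
  · rw [hφ]; exact ha
  · rw [hφ, aeval_X]; simp [g, hij]
  · rw [hφ, aeval_X]; simp [g, hi.symm, hj.symm]

theorem LA_branch {K : Type} [Field K] {F : MvPolynomial (Fin 3) K} (v : Fin 3 → K)
    (hv2 : v 2 ≠ 0) (hF : eval v F = 0) (hd : eval v (pderiv 0 F) ≠ 0 ∨ eval v (pderiv 1 F) ≠ 0) :
    ∃ φ : MvPolynomial (Fin 3) K →ₐ[K] PowerSeries K, φ F = 0 ∧
      ∃ τ z : MvPolynomial (Fin 3) K, τ.IsHomogeneous 1 ∧ z.IsHomogeneous 1 ∧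
        φ τ = PowerSeries.X ∧ φ z = 1 := by
  have : ∃ i j : Fin 3, i ≠ j ∧ i ≠ 2 ∧ j ≠ 2 ∧ eval v (pderiv j F) ≠ 0 := by
    rcases hd with h | h
    · exact ⟨1, 0, by decide, by decide, by decide, h⟩
    · exact ⟨0, 1, by decide, by decide, by decide, h⟩
  obtain ⟨i, j, hij, hi, hj, h⟩ := this
  obtain ⟨φ, h1, h2, h3⟩ := LA_branch_aux v hv2 hF i j hij hi hj h
  have hC : ∀ a : K, φ (C a) = PowerSeries.C a := fun a => by
    rw [show (C a : MvPolynomial (Fin 3) K) = algebraMap K _ a from rfl, AlgHom.commutes]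
    simp [PowerSeries.algebraMap_apply]
  refine ⟨φ, h1, X i - C (v i * (v 2)⁻¹) * X 2, C (v 2)⁻¹ * X 2, ?_, ?_, ?_, ?_⟩
  · exact (isHomogeneous_X _ _).sub (by simpa using (isHomogeneous_C (Fin 3) (v i * (v 2)⁻¹)).mul (isHomogeneous_X K (2 : Fin 3)))
  · simpa using (isHomogeneous_C (Fin 3) (v 2)⁻¹).mul (isHomogeneous_X K (2 : Fin 3))
  · rw [map_sub, map_mul, h2, h3, hC, ← map_mul, mul_assoc, inv_mul_cancel₀ hv2, mul_one]
    ring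
  · rw [map_mul, h3, hC, ← map_mul, inv_mul_cancel₀ hv2, map_one]

theorem LA_ord {K : Type} [Field K] {F u : MvPolynomial (Fin 3) K} {d l : ℕ}
    (hF : F.IsHomogeneous d) (hu : u.IsHomogeneous l) (hFp : Prime F) (hnd : ¬ F ∣ u)
    (φ : MvPolynomial (Fin 3) K →ₐ[K] PowerSeries K) (hφ : φ F = 0)
    (τ z : MvPolynomial (Fin 3) K) (hτ : τ.IsHomogeneous 1) (hz : z.IsHomogeneous 1)
    (hφτ : φ τ = PowerSeries.X) (hφz : φ z = 1) :
    ¬ (PowerSeries.X ^ (l * d + 1) ∣ φ u) := by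
  classical
  intro hdiv
  have := LA_bezout hF hu hFp hnd (T := Fin (l * d + 1))
    (fun t => (PowerSeries.coeff (R := K) t.1).comp φ.toLinearMap) (l * d + 1)
    (fun t h => by simp [hφ])
    (fun t h => by
      have h2 : PowerSeries.X ^ (l * d + 1) ∣ φ (u * h) := by
        rw [map_mul]; exact hdiv.mul_right _
      rw [PowerSeries.X_pow_dvd_iff] at h2
      exact h2 t.1 t.2)
    (fun n hn c hc => by
      funext j
      have h2 := hc (τ ^ j.1 * z ^ (n - j.1)) (by
        have := (hτ.pow j.1).mul (hz.pow (n - j.1))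
        convert this using 1
        have := j.2
        omega)
      simp only [LinearMap.comp_apply, AlgHom.toLinearMap_apply, map_mul, map_pow, hφτ, hφz, one_pow,
        mul_one, PowerSeries.coeff_X_pow] at h2
      rw [Finset.sum_eq_single j] at h2
      · simpa using h2
      · intro b _ hb
        rw [if_neg (fun h => hb (Fin.ext h)), mul_zero]
      · simp)
  simp at this

theorem LA_indep {K : Type} [Field K] (s : ℕ) (hs : ∀ a b : PowerSeries K, (a + b) ^ s = a ^ s + b ^ s)
    (U : Submodule K (PowerSeries K)) (hU : ∀ u ∈ U, PowerSeries.X ^ s ∣ u → u = 0) :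
    ∀ (n : ℕ) (v : Fin n → PowerSeries K), LinearIndependent K v → ∀ u : Fin n → PowerSeries K,
      (∀ i, u i ∈ U) → ∑ i, u i * v i ^ s = 0 → u = 0 := by
  intro n
  induction n with
  | zero => intro v _ u _ _; funext i; exact i.elim0
  | succ n ih =>
    intro v hv u hu hsum
    obtain ⟨i0, -, hi0⟩ := Finset.exists_min_image Finset.univ (fun i => (v i).order) ⟨0, Finset.mem_univ _⟩
    have hne : v i0 ≠ 0 := hv.ne_zero i0
    obtain ⟨o, ho⟩ : ∃ o : ℕ, (v i0).order = o := by
      have := PowerSeries.order_finite_iff_ne_zero.2 hne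
      exact ⟨(v i0).order.lift this, by simp⟩
    have hco : PowerSeries.coeff o (v i0) ≠ 0 := by
      have := PowerSeries.order_eq_nat.1 ho
      exact this.1
    have hlow : ∀ i, ∀ k < o, PowerSeries.coeff k (v i) = 0 := by
      intro i k hk
      apply PowerSeries.coeff_of_lt_order
      have := hi0 i (Finset.mem_univ _)
      rw [ho] at this
      exact lt_of_lt_of_le (by exact_mod_cast hk) this
    let c : Fin n → K := fun j => PowerSeries.coeff o (v (i0.succAbove j)) / PowerSeries.coeff o (v i0)
    let v' : Fin n → PowerSeries K := fun j => v (i0.succAbove j) - c j • v i0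
    have hv' : LinearIndependent K v' := by
      rw [Fintype.linearIndependent_iff] at hv ⊢
      intro g hg
      have := hv (Fin.insertNth (α := fun _ => K) i0 (-∑ j, g j * c j) g) (by
        rw [Fin.sum_univ_succAbove _ i0]
        simp only [Fin.insertNth_apply_same, Fin.insertNth_apply_succAbove]
        simp only [v', smul_sub, Finset.sum_sub_distrib, smul_smul] at hg
        rw [neg_smul, Finset.sum_smul, ← hg]
        abel)
      intro j
      have := this (i0.succAbove j)
      rwa [Fin.insertNth_apply_succAbove] at this
    have hdiv' : ∀ j, PowerSeries.X ^ (o + 1) ∣ v' j := by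
      intro j
      rw [PowerSeries.X_pow_dvd_iff]
      intro m hm
      simp only [v', map_sub, PowerSeries.coeff_smul]
      rcases Nat.lt_succ_iff_lt_or_eq.1 hm with h | h
      · rw [hlow _ _ h, hlow _ _ h]; simp
      · subst h
        simp only [c, smul_eq_mul]
        field_simp
        ring
    have hvj : ∀ j, v (i0.succAbove j) ^ s = v' j ^ s + (c j) ^ s • v i0 ^ s := by
      intro j
      rw [← smul_pow, ← hs]
      simp [v']
    rw [Fin.sum_univ_succAbove _ i0] at hsum
    have hsum2 : (u i0 + ∑ j, (c j) ^ s • u (i0.succAbove j)) * v i0 ^ s +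
        ∑ j, u (i0.succAbove j) * v' j ^ s = 0 := by
      rw [← hsum, add_mul, add_assoc, Finset.sum_mul, ← Finset.sum_add_distrib]
      congr 1
      refine Finset.sum_congr rfl fun j _ => ?_
      rw [hvj, mul_add, smul_mul_assoc, mul_smul_comm, add_comm]
    set u' := u i0 + ∑ j, (c j) ^ s • u (i0.succAbove j) with hu'
    have huU : u' ∈ U := U.add_mem (hu _) (U.sum_mem fun j _ => U.smul_mem _ (hu _))
    obtain ⟨g, hg⟩ : PowerSeries.X ^ o ∣ v i0 := PowerSeries.X_pow_dvd_iff.2 (fun m hm => hlow _ _ hm)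
    have hgc : PowerSeries.constantCoeff g ≠ 0 := by
      rw [hg] at hco
      simpa [PowerSeries.coeff_X_pow_mul'] using hco
    have hgu : IsUnit g := by
      rw [PowerSeries.isUnit_iff_constantCoeff]; exact isUnit_iff_ne_zero.2 hgc
    have hd1 : PowerSeries.X ^ ((o + 1) * s) ∣ ∑ j, u (i0.succAbove j) * v' j ^ s := by
      refine Finset.dvd_sum fun j _ => ?_
      rw [pow_mul]
      exact (pow_dvd_pow_of_dvd (hdiv' j) s).mul_left _
    have hd2 : PowerSeries.X ^ ((o + 1) * s) ∣ u' * v i0 ^ s := by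
      rw [eq_neg_of_add_eq_zero_left hsum2]
      exact hd1.neg_right
    have hd3 : (PowerSeries.X : PowerSeries K) ^ s ∣ u' := by
      rw [hg, mul_pow, ← pow_mul, add_mul, one_mul, pow_add, mul_left_comm] at hd2
      have := (mul_dvd_mul_iff_left (pow_ne_zero _ PowerSeries.X_ne_zero)).1 hd2
      exact ((hgu.pow s).dvd_mul_right).1 this
    have hu0 : u' = 0 := hU _ huU hd3
    rw [hu0, zero_mul, zero_add] at hsum2
    have hrest := ih v' hv' (fun j => u (i0.succAbove j)) (fun j => hu _) hsum2
    have hrest' : ∀ j, u (i0.succAbove j) = 0 := fun j => congrFun hrest j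
    have h0 : u i0 = 0 := by
      rw [hu'] at hu0
      simpa [hrest'] using hu0
    funext i
    rcases Fin.eq_self_or_eq_succAbove i0 i with h | ⟨j, h⟩
    · rw [h, h0]; rfl
    · rw [h, hrest']; rfl

/-- degree n piece of the homogeneous coordinate ring -/
noncomputable def LAS {K : Type} [Field K] (F : MvPolynomial (Fin 3) K) (n : ℕ) :
    Submodule K (MvPolynomial (Fin 3) K ⧸ Ideal.span {F}) :=
  (homogeneousSubmodule (Fin 3) K n).map (Ideal.Quotient.mkₐ K (Ideal.span {F})).toLinearMap

theorem LAS_fin {K : Type} [Field K] (F : MvPolynomial (Fin 3) K) (n : ℕ) : Module.Finite K (LAS F n) := by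
  have := LA_fin (K := K) n
  unfold LAS
  infer_instance

theorem LAS_rank {K : Type} [Field K] (F : MvPolynomial (Fin 3) K) (hF0 : F ≠ 0) (d r : ℕ)
    (hF : F.IsHomogeneous d) :
    2 * (Module.finrank K (LAS F (r + d)) : ℤ) = d * (2 * (r + d : ℕ) + 3 - d) := by
  have := LA_fin (K := K) (r + d)
  have := LA_fin (K := K) r
  let π := (Ideal.Quotient.mkₐ K (Ideal.span {F})).toLinearMap.comp
    (homogeneousSubmodule (Fin 3) K (r + d)).subtype
  have hr : LinearMap.range π = LAS F (r + d) := by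
    rw [LinearMap.range_comp, Submodule.range_subtype]; rfl
  let μ : homogeneousSubmodule (Fin 3) K r →ₗ[K] homogeneousSubmodule (Fin 3) K (r + d) :=
    ((LinearMap.mulLeft K F).comp (homogeneousSubmodule (Fin 3) K r).subtype).codRestrict _ (by
      rintro ⟨h, hh⟩
      have := hF.mul ((mem_homogeneousSubmodule _ _).1 hh)
      rw [add_comm] at this
      exact this)
  have hμ : Function.Injective μ := by
    intro x y hxy
    have : F * x.1 = F * y.1 := congrArg Subtype.val hxy
    exact Subtype.ext (mul_left_cancel₀ hF0 this)
  have hk : LinearMap.ker π = LinearMap.range μ := by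
    ext ⟨x, hx⟩
    rw [LinearMap.mem_ker]
    constructor
    · intro h
      have h1 : F ∣ x := by
        have : Ideal.Quotient.mk (Ideal.span {F}) x = 0 := h
        rwa [Ideal.Quotient.eq_zero_iff_mem, Ideal.mem_span_singleton] at this
      obtain ⟨g, hg, hxg⟩ := LA_hom_div hF ((mem_homogeneousSubmodule _ _).1 hx) h1
      exact ⟨⟨g, hg⟩, Subtype.ext hxg.symm⟩
    · rintro ⟨y, hy⟩
      have : x = F * y.1 := (congrArg Subtype.val hy).symm
      show Ideal.Quotient.mk (Ideal.span {F}) x = 0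
      rw [Ideal.Quotient.eq_zero_iff_mem, Ideal.mem_span_singleton]
      exact ⟨_, this⟩
  have h1 := LinearMap.finrank_range_add_finrank_ker π
  rw [hr, hk, LinearMap.finrank_range_of_inj hμ] at h1
  have f1 := LA_finrank2 (K := K) r
  have f2 := LA_finrank2 (K := K) (r + d)
  zify at h1
  push_cast at f1 f2 ⊢
  linarith

theorem LAS_rank_ge {K : Type} [Field K] (F : MvPolynomial (Fin 3) K) (hF0 : F ≠ 0) (d m : ℕ)
    (hF : F.IsHomogeneous d) :
    (d * (2 * m + 3 - d) : ℤ) ≤ 2 * (Module.finrank K (LAS F m) : ℤ) := by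
  by_cases hm : d ≤ m
  · obtain ⟨r, rfl⟩ := Nat.exists_eq_add_of_le' hm
    exact (LAS_rank F hF0 d r hF).ge
  · have hinj : Function.Injective ((Ideal.Quotient.mkₐ K (Ideal.span {F})).toLinearMap.comp
        (homogeneousSubmodule (Fin 3) K m).subtype) := by
      rw [← LinearMap.ker_eq_bot, LinearMap.ker_eq_bot']
      rintro ⟨x, hx⟩ h
      have h1 : F ∣ x := by
        have : Ideal.Quotient.mk (Ideal.span {F}) x = 0 := h
        rwa [Ideal.Quotient.eq_zero_iff_mem, Ideal.mem_span_singleton] at this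
      have hx0 : x = 0 := by
        by_contra hne
        obtain ⟨g, rfl⟩ := h1
        have hg : g ≠ 0 := right_ne_zero_of_mul hne
        have e1 := ((mem_homogeneousSubmodule _ _).1 hx).totalDegree hne
        rw [totalDegree_mul_of_isDomain hF0 hg, hF.totalDegree hF0] at e1
        omega
      exact Subtype.ext hx0
    have h2 := LinearMap.finrank_range_of_inj hinj
    have hr : LinearMap.range ((Ideal.Quotient.mkₐ K (Ideal.span {F})).toLinearMap.comp
        (homogeneousSubmodule (Fin 3) K m).subtype) = LAS F m := by
      rw [LinearMap.range_comp, Submodule.range_subtype]; rfl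
    rw [hr] at h2
    rw [h2, LA_finrank2]
    push Not at hm
    obtain ⟨k, rfl⟩ := Nat.exists_eq_add_of_lt hm
    push_cast
    nlinarith [mul_nonneg (Int.natCast_nonneg k) (Int.natCast_nonneg k), Int.natCast_nonneg k]

theorem LAS_basis {K : Type} [Field K] (F : MvPolynomial (Fin 3) K) (n : ℕ) :
    ∃ w : Fin (Module.finrank K (LAS F n)) → MvPolynomial (Fin 3) K, (∀ i, (w i).IsHomogeneous n) ∧
      ∀ c : Fin (Module.finrank K (LAS F n)) → K, F ∣ ∑ i, c i • w i → c = 0 := by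
  have := LAS_fin F n
  let bs := Module.finBasis K (LAS F n)
  have hex : ∀ i, ∃ w : MvPolynomial (Fin 3) K, w.IsHomogeneous n ∧
      Ideal.Quotient.mk (Ideal.span {F}) w = (bs i).1 := by
    intro i
    obtain ⟨w, hw, hw2⟩ := (bs i).2
    exact ⟨w, hw, hw2⟩
  choose w hw hw2 using hex
  refine ⟨w, hw, fun c hc => ?_⟩
  have h1 : ∑ i, c i • bs i = 0 := by
    apply Subtype.ext
    rw [← Ideal.mem_span_singleton, ← Ideal.Quotient.eq_zero_iff_mem, map_sum] at hc
    rw [Submodule.coe_sum, ZeroMemClass.coe_zero, ← hc]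
    refine Finset.sum_congr rfl fun i _ => ?_
    rw [Submodule.coe_smul, ← hw2]
    rfl
  funext i
  exact Fintype.linearIndependent_iff.1 bs.linearIndependent c h1 i

/-- the derivation along the curve -/
noncomputable def LAD {K : Type} [Field K] (F : MvPolynomial (Fin 3) K) :
    Derivation K (MvPolynomial (Fin 3) K) (MvPolynomial (Fin 3) K) :=
  pderiv 1 F • pderiv 0 - pderiv 0 F • pderiv 1

theorem LAD_apply {K : Type} [Field K] (F u : MvPolynomial (Fin 3) K) :
    LAD F u = pderiv 1 F * pderiv 0 u - pderiv 0 F * pderiv 1 u := rfl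

theorem LAD_self {K : Type} [Field K] (F : MvPolynomial (Fin 3) K) : LAD F F = 0 := by
  rw [LAD_apply]; ring

theorem LAD_hom {K : Type} [Field K] {F u : MvPolynomial (Fin 3) K} {d l : ℕ} (hd : 2 ≤ d) (hl : 1 ≤ l)
    (hF : F.IsHomogeneous d) (hu : u.IsHomogeneous l) : (LAD F u).IsHomogeneous (l + (d - 2)) := by
  rw [LAD_apply]
  rw [show l + (d - 2) = (d - 1) + (l - 1) by omega]
  exact (hF.pderiv.mul hu.pderiv).sub (hF.pderiv.mul hu.pderiv)

theorem LAD_pow_hom {K : Type} [Field K] {F u : MvPolynomial (Fin 3) K} {d l : ℕ} (hd : 2 ≤ d) (hl : 1 ≤ l)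
    (hF : F.IsHomogeneous d) (hu : u.IsHomogeneous l) (k : ℕ) :
    (((LAD F : MvPolynomial (Fin 3) K →ₗ[K] MvPolynomial (Fin 3) K) ^ k) u).IsHomogeneous
      (l + k * (d - 2)) := by
  induction k with
  | zero => simpa using hu
  | succ k ih =>
    rw [pow_succ']
    have := LAD_hom hd (by omega) hF ih
    rw [add_mul, one_mul, ← add_assoc]
    exact this

theorem LAD_pow_mul {K : Type} [Field K] (D : Derivation K (MvPolynomial (Fin 3) K) (MvPolynomial (Fin 3) K))
    (u x : MvPolynomial (Fin 3) K) (hx : D x = 0) (k : ℕ) :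
    ((D : MvPolynomial (Fin 3) K →ₗ[K] MvPolynomial (Fin 3) K) ^ k) (u * x) =
      ((D : MvPolynomial (Fin 3) K →ₗ[K] MvPolynomial (Fin 3) K) ^ k) u * x := by
  induction k with
  | zero => simp
  | succ k ih =>
    rw [pow_succ', Module.End.mul_apply, Module.End.mul_apply, ih]
    show D (_ * x) = D _ * x
    rw [Derivation.leibniz, hx, smul_zero, zero_add, smul_eq_mul, mul_comm]

theorem LAS_mem {K : Type} [Field K] (F u : MvPolynomial (Fin 3) K) (n : ℕ) (hu : u.IsHomogeneous n) :
    Ideal.Quotient.mk (Ideal.span {F}) u ∈ LAS F n :=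
  ⟨u, hu, rfl⟩

theorem LAS_basis' {K : Type} [Field K] (F : MvPolynomial (Fin 3) K) (n : ℕ) :
    ∃ N, N = Module.finrank K (LAS F n) ∧
    ∃ w : Fin N → MvPolynomial (Fin 3) K, (∀ i, (w i).IsHomogeneous n) ∧
      ∀ c : Fin N → K, F ∣ ∑ i, c i • w i → c = 0 :=
  ⟨_, rfl, LAS_basis F n⟩

set_option maxHeartbeats 1000000 in
open scoped LinearAlgebra.Projectivization in
theorem LA_stepanov {K : Type} [Field K] [Fintype K] (p : ℕ) [hp : Fact p.Prime] [CharP K p]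
    (b t : ℕ) (ht : 1 ≤ t) (hq : Fintype.card K = p ^ b * p ^ t)
    {F : MvPolynomial (Fin 3) K} {d : ℕ} (hd : 2 ≤ d) (hF : F.IsHomogeneous d) (hFp : Prime F)
    (e : ℕ) (hep : e ≤ p) (l m : ℕ) (hl : d ≤ l) (hls : l * d < p ^ t)
    (hdim : (4 * e * l * p ^ b + 2 * e * (e - 1) * (d - 2) * p ^ b + 2 * e * (2 * m + 3 - d) : ℤ) <
      (2 * m + 3 - d) * (d * (2 * l + 3 - d)))
    (T : Finset (ℙ K (Fin 3 → K))) (hTF : ∀ P ∈ T, eval P.rep F = 0) (hT2 : ∀ P ∈ T, P.rep 2 ≠ 0)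
    (hTs : ∀ P ∈ T, eval P.rep (pderiv 0 F) ≠ 0 ∨ eval P.rep (pderiv 1 F) ≠ 0) :
    e * T.card ≤ (l + m * p ^ t) * d := by
  classical
  rcases T.eq_empty_or_nonempty with rfl | ⟨P0, hP0⟩
  · simp
  have hF0 : F ≠ 0 := hFp.ne_zero
  obtain ⟨nl, hnl, w, hw, hwi⟩ := LAS_basis' F l
  obtain ⟨nm, hnm, v, hv, hvi⟩ := LAS_basis' F m
  set D := LAD F with hD
  let Dk : ℕ → MvPolynomial (Fin 3) K → MvPolynomial (Fin 3) K := fun k u =>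
    ((D : MvPolynomial (Fin 3) K →ₗ[K] MvPolynomial (Fin 3) K) ^ k) u
  let R : ℕ → ℕ := fun k => (l + k * (d - 2)) * p ^ b + m
  have hxmem : ∀ (k : ℕ) (ij : Fin nm × Fin nl),
      Ideal.Quotient.mk (Ideal.span {F}) ((Dk k (w ij.2)) ^ (p ^ b) * v ij.1) ∈ LAS F (R k) := by
    intro k ij
    apply LAS_mem
    exact ((LAD_pow_hom hd (by omega) hF (hw ij.2) k).pow (p ^ b)).mul (hv ij.1)
  let x : Fin nm × Fin nl → (∀ k : Fin e, LAS F (R k)) := fun ij k => ⟨_, hxmem k ij⟩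
  have hfin : ∀ n, Module.Finite K (LAS F n) := LAS_fin F
  have hdep : ¬ LinearIndependent K x := by
    intro hli
    have h1 := hli.fintype_card_le_finrank
    rw [Module.finrank_pi_fintype, Fintype.card_prod, Fintype.card_fin, Fintype.card_fin] at h1
    have h2 : ∀ k : ℕ, 2 * (Module.finrank K (LAS F (R k)) : ℤ) =
        d * (2 * ((l + k * (d - 2)) * p ^ b + m) + 3 - d) := by
      intro k
      have hB : 1 ≤ p ^ b := Nat.one_le_pow _ _ hp.out.pos
      have hRd : d ≤ R k := by
        have : l * 1 ≤ (l + k * (d - 2)) * p ^ b := Nat.mul_le_mul (by omega) hB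
        simp only [R]; omega
      obtain ⟨r, hr⟩ := Nat.exists_eq_add_of_le' hRd
      have := LAS_rank F hF0 d r hF
      rw [← hr] at this
      rw [this]
      simp only [R]
      push_cast [Nat.cast_sub hd]
      ring
    have h3 : 2 * ((∑ k : Fin e, Module.finrank K (LAS F (R k)) : ℕ) : ℤ) =
        d * (2 * e * l * p ^ b + e * (e - 1) * (d - 2) * p ^ b + e * (2 * m + 3 - d)) := by
      rw [Fin.sum_univ_eq_sum_range (fun k => Module.finrank K (LAS F (R k))) e]
      push_cast
      rw [Finset.mul_sum]
      simp_rw [h2]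
      clear * -
      induction e with
      | zero => simp
      | succ e ih =>
        rw [Finset.sum_range_succ, ih]
        push_cast
        ring
    have h4 := LAS_rank_ge F hF0 d m hF
    have h5 := LAS_rank_ge F hF0 d l hF
    rw [← hnl] at h5
    rw [← hnm] at h4
    have h1' : ((nm : ℤ) * nl) ≤ ((∑ k : Fin e, Module.finrank K (LAS F (R k)) : ℕ) : ℤ) := by
      exact_mod_cast h1
    have hl' : (d : ℤ) ≤ l := by exact_mod_cast hl
    have hd' : (2 : ℤ) ≤ d := by exact_mod_cast hd
    have h6 : ((d * (2 * m + 3 - d)) * (d * (2 * l + 3 - d)) : ℤ) ≤ (2 * nm) * (2 * nl) :=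
      mul_le_mul h4 h5 (by apply mul_nonneg <;> linarith) (by positivity)
    have h7 := mul_lt_mul_of_pos_left hdim (show (0 : ℤ) < d by linarith)
    linarith
  obtain ⟨c, hc, hc0⟩ := Fintype.not_linearIndependent_iff.1 hdep
  have hB : ∀ ij, (c ij ^ (p ^ t)) ^ (p ^ b) = c ij := by
    intro ij
    rw [← pow_mul, mul_comm, ← hq, FiniteField.pow_card]
  let a : Fin nm × Fin nl → K := fun ij => c ij ^ (p ^ t)
  have hH : ∀ k < e, F ∣ ∑ ij, c ij • ((Dk k (w ij.2)) ^ (p ^ b) * v ij.1) := by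
    intro k hk
    rw [← Ideal.mem_span_singleton, ← Ideal.Quotient.eq_zero_iff_mem, map_sum]
    have := congrArg Subtype.val (congrFun hc ⟨k, hk⟩)
    simp only [Finset.sum_apply, Pi.smul_apply, Pi.zero_apply, Submodule.coe_sum, Submodule.coe_smul,
      ZeroMemClass.coe_zero] at this
    rw [← this]
    rfl
  let G : MvPolynomial (Fin 3) K := ∑ ij, a ij • (w ij.2 * v ij.1 ^ (p ^ t))
  have hG : G.IsHomogeneous (l + m * p ^ t) := by
    refine IsHomogeneous.sum _ _ _ fun ij _ => ?_
    rw [smul_eq_C_mul]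
    simpa using (isHomogeneous_C (Fin 3) (a ij)).mul ((hw ij.2).mul ((hv ij.1).pow (p ^ t)))
  have hcast : ((p ^ t : ℕ) : MvPolynomial (Fin 3) K) = 0 := by
    rw [Nat.cast_pow, CharP.cast_eq_zero, zero_pow (by omega)]
  have hDv : ∀ i, D (v i ^ (p ^ t)) = 0 := by
    intro i
    rw [Derivation.leibniz_pow, ← Nat.cast_smul_eq_nsmul (MvPolynomial (Fin 3) K), hcast, zero_smul]
  have hDG : ∀ k, Dk k G = ∑ ij, a ij • (Dk k (w ij.2) * v ij.1 ^ (p ^ t)) := by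
    intro k
    simp only [Dk, G, map_sum, map_smul]
    refine Finset.sum_congr rfl fun ij _ => ?_
    rw [LAD_pow_mul D _ _ (hDv _)]
  have hvan : ∀ P ∈ T, LAvan D P.rep e G := by
    intro P hP k hk
    show eval P.rep (Dk k G) = 0
    have hB0 : p ^ b ≠ 0 := (pow_pos hp.out.pos _).ne'
    rw [← pow_eq_zero_iff hB0, hDG, map_sum, sum_pow_char_pow]
    obtain ⟨g, hg⟩ := hH k hk
    have h1 := congrArg (eval P.rep) hg
    rw [map_mul, hTF P hP, zero_mul, map_sum] at h1
    rw [← h1]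
    refine Finset.sum_congr rfl fun ij _ => ?_
    rw [smul_eval, smul_eval, map_mul, map_mul, map_pow, map_pow, mul_pow, mul_pow, hB]
    congr 2
    rw [← pow_mul, mul_comm, ← hq, FiniteField.pow_card]
  have hnd : ¬ F ∣ G := by
    intro hdiv
    obtain ⟨φ, hφ, τ, z, hτ, hz, hφτ, hφz⟩ := LA_branch P0.rep (hT2 _ hP0) (hTF _ hP0) (hTs _ hP0)
    have hφG : φ G = 0 := by
      obtain ⟨g, hg⟩ := hdiv
      rw [hg, map_mul, hφ, zero_mul]
    have hkey : ∀ {n : ℕ} (u : MvPolynomial (Fin 3) K), u.IsHomogeneous n →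
        PowerSeries.X ^ (n * d + 1) ∣ φ u → F ∣ u := by
      intro n u hu hX
      by_contra hn
      exact LA_ord hF hu hFp hn φ hφ τ z hτ hz hφτ hφz hX
    have : CharP (PowerSeries K) p := charP_of_injective_algebraMap
      (FaithfulSMul.algebraMap_injective K (PowerSeries K)) p
    have hsumhom : ∀ {n N : ℕ} (f : Fin N → MvPolynomial (Fin 3) K) (hf : ∀ i, (f i).IsHomogeneous n)
        (g : Fin N → K), (∑ i, g i • f i).IsHomogeneous n := by
      intro n N f hf g
      refine IsHomogeneous.sum _ _ _ fun i _ => ?_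
      rw [smul_eq_C_mul]
      simpa using (isHomogeneous_C (Fin 3) (g i)).mul (hf i)
    have hres := LA_indep (p ^ t) (fun x y => add_pow_char_pow x y p t)
      ((homogeneousSubmodule (Fin 3) K l).map φ.toLinearMap)
      (by
        rintro _ ⟨u, hu, rfl⟩ hX
        have : F ∣ u := hkey u hu ((pow_dvd_pow _ (by omega)).trans hX)
        obtain ⟨g, rfl⟩ := this
        show φ (F * g) = 0
        rw [map_mul, hφ, zero_mul])
      nm (fun i => φ (v i))
      (by
        rw [Fintype.linearIndependent_iff]
        intro g hg
        have h1 : φ (∑ i, g i • v i) = 0 := by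
          rw [map_sum, ← hg]
          simp only [map_smul]
        have := hvi g (hkey _ (hsumhom v hv g) (by rw [h1]; exact dvd_zero _))
        intro i; rw [this]; rfl)
      (fun i => φ (∑ j, a (i, j) • w j))
      (fun i => ⟨_, hsumhom w hw _, rfl⟩)
      (by
        rw [← hφG]
        simp only [G, map_sum, map_smul, map_mul, map_pow, Fintype.sum_prod_type, Finset.sum_mul,
          smul_mul_assoc])
    obtain ⟨⟨i, j⟩, hij⟩ := hc0
    have h1 : φ (∑ j, a (i, j) • w j) = 0 := congrFun hres i
    have h2 := hwi _ (hkey _ (hsumhom w hw _) (by rw [h1]; exact dvd_zero _))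
    have h3 : a (i, j) = 0 := congrFun h2 j
    apply hij
    rw [← hB]
    show a (i, j) ^ _ = 0
    rw [h3, zero_pow (pow_pos hp.out.pos _).ne']
  refine LA_points D hF hG hFp hnd (LAD_self F) e ?_ T hTF hvan ?_
  · intro j hj h0
    rw [CharP.cast_eq_zero_iff K p] at h0
    have := (hp.out.dvd_factorial).1 h0
    omega
  · intro _ P hP
    have h2 := hT2 P hP
    have hlin : ∀ i : Fin 3, (X i - C (P.rep i * (P.rep 2)⁻¹) * X 2 : MvPolynomial (Fin 3) K).IsHomogeneous 1 :=
      fun i => (isHomogeneous_X _ _).sub (by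
        simpa using (isHomogeneous_C (Fin 3) (P.rep i * (P.rep 2)⁻¹)).mul (isHomogeneous_X K (2 : Fin 3)))
    have hev : ∀ i : Fin 3, eval P.rep (X i - C (P.rep i * (P.rep 2)⁻¹) * X 2 : MvPolynomial (Fin 3) K) = 0 := by
      intro i
      simp only [map_sub, map_mul, eval_X, eval_C]
      field_simp
      ring
    rcases hTs P hP with h | h
    · refine ⟨_, hlin 1, hev 1, ?_⟩
      rw [hD, LAD_apply]
      simp only [map_sub, map_mul, Derivation.leibniz, pderiv_C, pderiv_X]
      simpa [Pi.single_apply] using h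
    · refine ⟨_, hlin 0, hev 0, ?_⟩
      rw [hD, LAD_apply]
      simp only [map_sub, map_mul, Derivation.leibniz, pderiv_C, pderiv_X]
      simpa [Pi.single_apply] using h

theorem LA_num1 (d s ρ c : ℝ) (hd : 4 ≤ d) (hc : 1.2071 ≤ c) (h1 : 0.866 ≤ ρ) (h2 : ρ ≤ 1.41422)
    (hs : c * d * (d - 1) * (d - 2) ≤ s) :
    ρ * (1 + d * (d - 1) / 2) + (25 / 48) / ρ * (d ^ 2 - 2 * d + 2) + d ^ 2 / s ≤ c * d * (d - 1) := by
  have hpos : 0 < d * (d - 1) * (d - 2) := by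
    apply mul_pos (mul_pos _ _) <;> linarith
  have hs' : 1.2071 * (d * (d - 1) * (d - 2)) ≤ s := by
    have := mul_le_mul_of_nonneg_right hc hpos.le
    linarith
  have hs0 : 0 < s := by linarith
  have hA : d ^ 2 / s ≤ 0.5523 := by
    rw [div_le_iff₀ hs0]
    have : 0 ≤ d * ((2 * d - 1) * (d - 4)) := by
      apply mul_nonneg (by linarith) (mul_nonneg _ _) <;> linarith
    nlinarith
  have hD : 12 ≤ d * (d - 1) := by nlinarith
  set D := d * (d - 1) with hDd
  have hρ : 0 < ρ := by linarith
  have hM : 1.2071 * D ≤ c * D := mul_le_mul_of_nonneg_right hc (by linarith)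
  have hmain : ρ * (1 + D / 2) + (25 / 48) / ρ * (d ^ 2 - 2 * d + 2) ≤ 1.2071 * D - 0.5523 := by
    have e1 : d ^ 2 - 2 * d + 2 = D - d + 2 := by rw [hDd]; ring
    rw [e1]
    have : ρ * (1 + D / 2) + (25 / 48) / ρ * (D - d + 2) =
      (ρ ^ 2 * (1 + D / 2) + (25 / 48) * (D - d + 2)) / ρ := by field_simp
    rw [this, div_le_iff₀ hρ]
    have hch : ρ ^ 2 ≤ (0.866 + 1.41422) * ρ - 0.866 * 1.41422 := by
      nlinarith [mul_nonneg (sub_nonneg.2 h1) (sub_nonneg.2 h2)]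
    have h3 := mul_le_mul_of_nonneg_right hch (show 0 ≤ 1 + D / 2 by linarith)
    have h4 : ((0.866 + 1.41422) * ρ - 0.866 * 1.41422) * (1 + D / 2) + (25 / 48) * (D - d + 2)
        - (1.2071 * D - 0.5523) * ρ ≤ 0 := by
      have ea : 0 ≤ (ρ - 0.866) * (D - 12) := mul_nonneg (by linarith) (by linarith)
      have eb : 0 ≤ (1.41422 - ρ) * (D - 12) := mul_nonneg (by linarith) (by linarith)
      nlinarith
    linarith
  have : c * d * (d - 1) = c * D := by rw [hDd]; ring
  rw [this]
  linarith

set_option maxHeartbeats 4000000 in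
theorem LA_num2 (q B e s' d : ℕ) (hd : 4 ≤ d) (he : 1 ≤ e) (hB : 1 ≤ B) (hq : q = B * s')
    (h3 : 3 * (e * B) ^ 2 ≤ 4 * q) (h2 : q ≤ 2 * (e * B) ^ 2)
    (hqd : (q : ℝ) > ((1 + Real.sqrt 2) / 2) ^ 2 * (d : ℝ) ^ 2 * ((d : ℝ) - 1) ^ 2 * ((d : ℝ) - 2) ^ 2) :
    ∃ l m : ℕ, d ≤ l ∧ l * d < s' ∧
      (4 * e * l * B + 2 * e * (e - 1) * (d - 2) * B + 2 * e * (2 * m + 3 - d) : ℤ) <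
      (2 * m + 3 - d) * (d * (2 * l + 3 - d)) ∧
      (((l + m * s') * d : ℕ) : ℝ) ≤
        e * (q + (1 + Real.sqrt 2) / 2 * Real.sqrt q * d * (d - 1) - d ^ 2) := by
  set c : ℝ := (1 + Real.sqrt 2) / 2 with hc
  have hs2 : Real.sqrt 2 ^ 2 = 2 := Real.sq_sqrt (by norm_num)
  have hs2a : 1.4142 ≤ Real.sqrt 2 := Real.le_sqrt_of_sq_le (by norm_num)
  have hc1 : 1.2071 ≤ c := by rw [hc]; linarith
  set s := Real.sqrt q with hs
  have hsq : s ^ 2 = q := Real.sq_sqrt (by positivity)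
  have hd' : (4 : ℝ) ≤ d := by exact_mod_cast hd
  have hpos : 0 < (d : ℝ) * (d - 1) * (d - 2) := by
    apply mul_pos (mul_pos _ _) <;> linarith
  have hsd : c * d * (d - 1) * (d - 2) ≤ s := by
    apply Real.le_sqrt_of_sq_le
    refine le_trans (le_of_eq ?_) hqd.le
    ring
  have hs0 : 0 < s := by
    have := mul_pos (show 0 < c by linarith) hpos
    linarith
  have he' : (1 : ℝ) ≤ e := by exact_mod_cast he
  have hB' : (1 : ℝ) ≤ B := by exact_mod_cast hB
  obtain ⟨x, hx⟩ : ∃ x : ℝ, x = s' / e := ⟨_, rfl⟩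
  have hsxeq : (s' : ℝ) = e * x := by rw [hx]; field_simp
  obtain ⟨σ, hσ⟩ : ∃ σ : ℝ, σ = e * B := ⟨_, rfl⟩
  have hσ0 : 0 < σ := by rw [hσ]; positivity
  have hqR : (q : ℝ) = B * s' := by exact_mod_cast hq
  have hxσ : x * σ = s ^ 2 := by rw [hsq, hqR, hsxeq, hσ]; ring
  have h3R : 3 * σ ^ 2 ≤ 4 * s ^ 2 := by rw [hsq, hσ]; exact_mod_cast h3
  have h2R : s ^ 2 ≤ 2 * σ ^ 2 := by rw [hsq, hσ]; exact_mod_cast h2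
  obtain ⟨ρ, hρ⟩ : ∃ ρ : ℝ, ρ = s / σ := ⟨_, rfl⟩
  have hρ0 : 0 < ρ := by rw [hρ]; positivity
  have hxρ : x = ρ * s := by
    rw [hρ]; field_simp; linarith
  have hsρ : s = ρ * σ := by rw [hρ]; field_simp
  have hρ1 : 0.75 ≤ ρ ^ 2 := by
    rw [hρ, div_pow, le_div_iff₀ (by positivity)]; linarith
  have hρ2 : ρ ^ 2 ≤ 2 := by
    rw [hρ, div_pow, div_le_iff₀ (by positivity)]; linarith
  have hρ1' : 0.866 ≤ ρ := by
    by_contra h; push Not at h; nlinarith only [h, hρ1, hρ0]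
  have hρ2' : ρ ≤ 1.41422 := by
    by_contra h; push Not at h; nlinarith only [h, hρ2]
  have hxd : (d : ℝ) * (d - 1) * (d - 2) * 1.045 ≤ x := by
    have : 1.2071 * (d * (d - 1) * (d - 2)) ≤ s := by
      have := mul_le_mul_of_nonneg_right hc1 hpos.le
      linarith
    rw [hxρ]
    have h6 : 0.866 * (1.2071 * (d * (d - 1) * (d - 2))) ≤ ρ * s :=
      mul_le_mul hρ1' this (by positivity) hρ0.le
    linarith
  have hx25 : 25 ≤ x := by
    have : (24 : ℝ) ≤ d * (d - 1) * (d - 2) := by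
      have : (12 : ℝ) ≤ d * (d - 1) := by nlinarith only [hd']
      nlinarith only [hd', this]
    linarith
  have hx1 : (d : ℝ) * (d - 1) * (d - 2) ≤ x := by linarith
  set W : ℝ := (d : ℝ) ^ 2 - 2 * d + 2 with hW
  have hWx : W * (d - 1) ≤ 2 * x - 2 := by
    have h6 : 2 ≤ ((d : ℝ) - 1) * (d * (d - 2) - 2) := by
      have : (6 : ℝ) ≤ d * (d - 2) - 2 := by nlinarith only [hd']
      nlinarith only [hd', this]
    rw [hW]; linarith only [h6, hx1]
  have hW0 : 0 < W := by rw [hW]; nlinarith only [hd']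
  have hdpos : 0 < d := by omega
  have hsone : 1 ≤ s' := by
    have : (0 : ℝ) < s' := by rw [hsxeq]; positivity
    exact_mod_cast this
  let l := (s' - 1) / d
  have hl1 : l * d ≤ s' - 1 := Nat.div_mul_le_self _ _
  have hl2 : s' ≤ l * d + d := by
    have := Nat.lt_div_mul_add (a := s' - 1) hdpos
    simp only [l]; omega
  have hl1' : (l : ℝ) * d ≤ s' - 1 := by
    have : l * d + 1 ≤ s' := by omega
    have : ((l * d + 1 : ℕ) : ℝ) ≤ s' := by exact_mod_cast this
    push_cast at this; linarith
  have hl2' : (s' : ℝ) ≤ l * d + d := by exact_mod_cast hl2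
  have hsxle : x ≤ s' := by rw [hsxeq]; nlinarith only [he', hx25]
  have hdl : d ≤ l := by
    have : (d : ℝ) * (d + 1) ≤ s' := by
      have : (d : ℝ) * (d + 1) ≤ d * (d - 1) * (d - 2) := by
        have h7 : (d : ℝ) + 1 ≤ (d - 1) * (d - 2) := by nlinarith only [hd']
        have := mul_le_mul_of_nonneg_left h7 (show (0 : ℝ) ≤ d by linarith)
        linarith only [this]
      linarith
    have : d * (d + 1) ≤ s' := by exact_mod_cast this
    by_contra h
    have : l * d ≤ (d - 1) * d := Nat.mul_le_mul_right _ (by omega)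
    have h5 : (d - 1) * d + d = d * d := by
      obtain ⟨k, rfl⟩ := Nat.exists_eq_add_of_le' hdpos
      simp; ring
    rw [Nat.mul_add, mul_one] at *
    omega
  obtain ⟨A, hA⟩ : ∃ A : ℝ, A = l * d := ⟨_, rfl⟩
  obtain ⟨Δ, hΔ⟩ : ∃ Δ : ℝ, Δ = 2 * A - d * (d - 3) - 2 * e := ⟨_, rfl⟩
  have hΔge : 2 * e * (x - 1) - d * (d - 1) ≤ Δ := by
    rw [hΔ, hA]; linarith only [hl2', hsxeq]
  have hΔ0 : 0 < Δ := by
    have : 2 * (x - 1) ≤ 2 * e * (x - 1) := by nlinarith only [he', hx25]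
    have h8 : (d : ℝ) * (d - 1) < W * (d - 1) := by
      apply mul_lt_mul_of_pos_right _ (by linarith)
      rw [hW]; nlinarith only [hd']
    linarith only [this, h8, hWx, hΔge]
  obtain ⟨R, hR⟩ : ∃ R : ℝ, R = 4 * l * σ + 2 * (e - 1) * (d - 2) * σ := ⟨_, rfl⟩
  have hR0 : 0 ≤ R := by
    rw [hR]
    have : 0 ≤ (e - 1 : ℝ) * (d - 2) := mul_nonneg (by linarith) (by linarith)
    have : 0 ≤ (e - 1 : ℝ) * (d - 2) * σ := mul_nonneg this hσ0.le
    have : (0 : ℝ) ≤ l * σ := by positivity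
    linarith
  obtain ⟨T, hT⟩ : ∃ T : ℝ, T = e * W - d := ⟨_, rfl⟩
  have hRT : R * d = 2 * σ * (Δ + T) := by
    rw [hR, hΔ, hA, hT, hW]; ring
  let m := ⌊(R / Δ + d - 3) / 2⌋₊ + 1
  have hn0 : 0 ≤ (R / Δ + d - 3) / 2 := by
    have : 0 ≤ R / Δ := div_nonneg hR0 hΔ0.le
    linarith
  have hm1 : R / Δ < 2 * m + 3 - d := by
    have := Nat.lt_floor_add_one ((R / Δ + d - 3) / 2)
    simp only [m]; push_cast; linarith
  have hm2 : 2 * (m : ℝ) ≤ R / Δ + d - 1 := by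
    have := Nat.floor_le hn0
    simp only [m]; push_cast; linarith
  have hTΔ : T / Δ ≤ W / (2 * x - 2) := by
    rw [div_le_div_iff₀ hΔ0 (by linarith)]
    have h5 : W * (2 * e * (x - 1) - d * (d - 1)) ≤ W * Δ := mul_le_mul_of_nonneg_left hΔge hW0.le
    have h6 : (d : ℝ) * (W * (d - 1)) ≤ d * (2 * x - 2) := mul_le_mul_of_nonneg_left hWx (by linarith)
    rw [hT]
    linarith
  have hmd : (m : ℝ) * d ≤ σ + σ * (W / (2 * x - 2)) + d * (d - 1) / 2 := by
    have h5 : R / Δ * d = 2 * σ + 2 * (σ * (T / Δ)) := by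
      rw [div_mul_eq_mul_div, hRT]; field_simp
    have h6 := mul_le_mul_of_nonneg_right hm2 (show (0 : ℝ) ≤ d by linarith)
    have h7 := mul_le_mul_of_nonneg_left hTΔ hσ0.le
    linarith only [h5, h6, h7]
  refine ⟨l, m, hdl, by omega, ?_, ?_⟩
  · rw [div_lt_iff₀ hΔ0, hR, hΔ, hA, hσ] at hm1
    have : ((4 * e * l * B + 2 * e * (e - 1) * (d - 2) * B + 2 * e * (2 * m + 3 - d) : ℤ) : ℝ) <
      (((2 * m + 3 - d) * (d * (2 * l + 3 - d)) : ℤ) : ℝ) := by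
      push_cast
      linarith
    exact_mod_cast this
  · have hN := LA_num1 d s ρ c hd' hc1 hρ1' hρ2' hsd
    push_cast
    have h5 : (s' : ℝ) * (m * d) ≤ s' * (σ + σ * (W / (2 * x - 2)) + d * (d - 1) / 2) :=
      mul_le_mul_of_nonneg_left hmd (by positivity)
    have h6 : (s' : ℝ) * (σ + σ * (W / (2 * x - 2)) + d * (d - 1) / 2) =
        e * (s ^ 2 + s ^ 2 * (W / (2 * x - 2)) + x * (d * (d - 1) / 2)) := by
      rw [← hxσ, hsxeq]; ring
    have h7 : s ^ 2 * (W / (2 * x - 2)) ≤ s * ((25 / 48) / ρ * W) := by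
      have : s * (1 / (2 * x - 2)) ≤ (25 / 48) / ρ := by
        rw [mul_one_div, div_le_div_iff₀ (by linarith) hρ0]
        linarith
      have := mul_le_mul_of_nonneg_right this hW0.le
      have := mul_le_mul_of_nonneg_left this hs0.le
      refine le_trans (le_of_eq ?_) this
      ring
    have h8 := mul_le_mul_of_nonneg_left hN hs0.le
    have h9 : s * (ρ * (1 + d * (d - 1) / 2) + 25 / 48 / ρ * W + d ^ 2 / s) =
        x * (1 + d * (d - 1) / 2) + s * ((25 / 48) / ρ * W) + d ^ 2 := by
      rw [hxρ]; field_simp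
    rw [h9] at h8
    have h10 : (e : ℝ) * (x + s ^ 2 + s ^ 2 * (W / (2 * x - 2)) + x * (d * (d - 1) / 2)) ≤
        e * (s ^ 2 + s * (c * d * (d - 1)) - d ^ 2) :=
      mul_le_mul_of_nonneg_left (by linarith) (by linarith)
    have h11 : (e : ℝ) * (q + c * s * d * (d - 1) - d ^ 2) = e * (s ^ 2 + s * (c * d * (d - 1)) - d ^ 2) := by
      rw [hsq]; ring
    rw [h11]
    have h12 : ((l : ℝ) + m * s') * d = l * d + s' * (m * d) := by ring
    rw [h12]
    linarith

theorem LA_par (p n : ℕ) (hp : 2 ≤ p) (hn : 1 ≤ n) : ∃ b t e : ℕ, 1 ≤ t ∧ n = b + t ∧ 1 ≤ e ∧ e ≤ p ∧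
    3 * (e * p ^ b) ^ 2 ≤ 4 * p ^ n ∧ p ^ n ≤ 2 * (e * p ^ b) ^ 2 := by
  rcases Nat.even_or_odd' n with ⟨k, rfl | rfl⟩
  · refine ⟨k, k, 1, by omega, by omega, le_rfl, by omega, ?_, ?_⟩
    · rw [one_mul, ← pow_mul, mul_comm k]; omega
    · rw [one_mul, ← pow_mul, mul_comm k]; omega
  · have hex : ∃ e : ℕ, p ≤ e * (e + 1) := ⟨p, by nlinarith⟩
    classical
    let e := Nat.find hex
    have h1 : p ≤ e * (e + 1) := Nat.find_spec hex
    have he : 1 ≤ e := by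
      rcases Nat.eq_zero_or_pos e with h | h
      · rw [h] at h1; omega
      · exact h
    obtain ⟨f, hf⟩ := Nat.exists_eq_add_of_le' he
    have h2 : f * (f + 1) < p := by
      have := Nat.find_min hex (m := f) (by show f < e; omega)
      omega
    rw [hf] at h1
    have hpp : p ^ (2 * k + 1) = p * (p ^ k) ^ 2 := by rw [pow_succ, pow_mul']; ring
    refine ⟨k, k + 1, e, by omega, by omega, he, ?_, ?_, ?_⟩
    · rw [hf]; nlinarith
    · rw [hf, hpp, mul_pow, ← mul_assoc, ← mul_assoc]
      apply Nat.mul_le_mul_right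
      have : (3 * (f + 1) ^ 2 : ℤ) ≤ 4 * p := by
        have : ((f * (f + 1) + 1 : ℕ) : ℤ) ≤ p := by exact_mod_cast h2
        push_cast at this
        nlinarith [sq_nonneg ((f : ℤ) - 1)]
      exact_mod_cast this
    · rw [hf, hpp, mul_pow, ← mul_assoc]
      apply Nat.mul_le_mul_right
      nlinarith

theorem LA_pth {K : Type} [Field K] [Fintype K] (p : ℕ) [hp : Fact p.Prime] [CharP K p]
    (F : MvPolynomial (Fin 3) K) (h : ∀ i, pderiv i F = 0) : ∃ g, F = g ^ p := by
  classical
  have hm : ∀ m ∈ F.support, ∃ g : MvPolynomial (Fin 3) K, monomial m (coeff m F) = g ^ p := by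
    intro m hm
    have hdiv : ∀ i, p ∣ m i := by
      intro i
      by_cases h0 : m i = 0
      · rw [h0]; exact dvd_zero _
      have h1 := congrArg (coeff (m - Finsupp.single i 1)) (h i)
      rw [coeff_pderiv, coeff_zero] at h1
      have h2 : m - Finsupp.single i 1 + Finsupp.single i 1 = m := by
        ext j
        by_cases hj : i = j
        · subst hj; simp; omega
        · simp [hj]
      rw [h2] at h1
      have h3 := (mul_eq_zero.1 h1).resolve_left (mem_support_iff.1 hm)
      rw [← CharP.cast_eq_zero_iff K p, ← h3]
      simp
      rw [Nat.cast_sub (by omega)]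
      simp
    obtain ⟨a, ha⟩ := Finite.injective_iff_surjective.1 (frobenius_inj K p) (coeff m F)
    choose f hf using hdiv
    refine ⟨monomial (Finsupp.equivFunOnFinite.symm f) a, ?_⟩
    rw [monomial_pow, ← ha]
    have hmf : m = p • Finsupp.equivFunOnFinite.symm f := by
      ext i
      simp [hf i]
    rw [← hmf]
    rfl
  choose! g hg using hm
  refine ⟨∑ m ∈ F.support, g m, ?_⟩
  rw [sum_pow_char]
  conv_lhs => rw [F.as_sum]
  exact Finset.sum_congr rfl fun m hmm => hg m hmm

theorem LA_ndvd {K : Type} [Field K] {F G : MvPolynomial (Fin 3) K} {d r : ℕ} (hF : F.IsHomogeneous d)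
    (hF0 : F ≠ 0) (hG : G.IsHomogeneous r) (hG0 : G ≠ 0) (hr : r < d) : ¬ F ∣ G := by
  rintro ⟨g, rfl⟩
  have hg : g ≠ 0 := right_ne_zero_of_mul hG0
  have e1 := hG.totalDegree hG0
  rw [totalDegree_mul_of_isDomain hF0 hg, hF.totalDegree hF0] at e1
  omega

theorem LA_sing {K : Type} [Field K] [Fintype K] (p : ℕ) [hp : Fact p.Prime] [CharP K p]
    {F : MvPolynomial (Fin 3) K} {d : ℕ} (hd : 2 ≤ d) (hF : F.IsHomogeneous d) (hFi : Irreducible F) :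
    pderiv 0 F ≠ 0 ∨ pderiv 1 F ≠ 0 := by
  by_contra hcon
  push Not at hcon
  obtain ⟨h0, h1⟩ := hcon
  have heul := hF.sum_X_mul_pderiv
  rw [Fin.sum_univ_three, h0, h1, mul_zero, mul_zero, zero_add, zero_add] at heul
  have hF0 := hFi.ne_zero
  have h2 : pderiv 2 F = 0 := by
    by_contra h2
    have hX : F ∣ X 2 * pderiv 2 F := by
      rw [heul, nsmul_eq_mul]; exact Dvd.intro_left _ rfl
    rcases hFi.prime.dvd_or_dvd hX with h | h
    · exact LA_ndvd hF hF0 (isHomogeneous_X K 2) (X_ne_zero 2) (by omega) h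
    · exact LA_ndvd hF hF0 hF.pderiv h2 (by omega) h
  obtain ⟨g, hg⟩ := LA_pth p F (by
    intro i
    fin_cases i
    · exact h0
    · exact h1
    · exact h2)
  rw [hg] at hFi
  exact not_irreducible_pow hp.out.one_lt.ne' hFi

theorem LA_eval_smul {K : Type} [Field K] {F : MvPolynomial (Fin 3) K} {d : ℕ} (hF : F.IsHomogeneous d)
    (a : K) (v : Fin 3 → K) : eval (a • v) F = a ^ d * eval v F := by
  rw [eval_eq, eval_eq, Finset.mul_sum]
  refine Finset.sum_congr rfl fun m hm => ?_
  have h1 := hF.degree_eq_sum_deg_support hm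
  simp only [Pi.smul_apply, smul_eq_mul, mul_pow]
  rw [Finset.prod_mul_distrib]
  have : ∏ i ∈ m.support, a ^ m i = a ^ d := by
    rw [Finset.prod_pow_eq_pow_sum, ← h1]
  rw [this]; ring

open scoped LinearAlgebra.Projectivization in
theorem LA_bez1 {K : Type} [Field K] {F G : MvPolynomial (Fin 3) K} {d r : ℕ}
    (hF : F.IsHomogeneous d) (hFi : Irreducible F) (hG : G.IsHomogeneous r) (hG0 : G ≠ 0) (hr : r < d)
    (T : Finset (ℙ K (Fin 3 → K))) (hTF : ∀ P ∈ T, eval P.rep F = 0)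
    (hTG : ∀ P ∈ T, eval P.rep G = 0) : T.card ≤ r * d := by
  have := LA_points (LAD F) hF hG hFi.prime (LA_ndvd hF hFi.ne_zero hG hG0 hr) (LAD_self F) 1
    (by intro j hj; rw [Nat.lt_one_iff.1 hj]; simp) T hTF
    (by
      intro P hP k hk
      rw [Nat.lt_one_iff.1 hk]
      simpa using hTG P hP)
    (by intro h; omega)
  simpa using this

open scoped LinearAlgebra.Projectivization in
theorem LA_count {K : Type} [Field K] [Fintype K] {F : MvPolynomial (Fin 3) K} {d : ℕ} (hd : 4 ≤ d)
    (hF : F.IsHomogeneous d) (hFi : Irreducible F)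
    (hq : (Fintype.card K : ℝ) >
      ((1 + Real.sqrt 2) / 2) ^ 2 * (d : ℝ) ^ 2 * ((d : ℝ) - 1) ^ 2 * ((d : ℝ) - 2) ^ 2)
    (T : Finset (ℙ K (Fin 3 → K))) (hTF : ∀ P ∈ T, eval P.rep F = 0) :
    (T.card : ℝ) ≤ Fintype.card K + (1 + Real.sqrt 2) / 2 * Real.sqrt (Fintype.card K) * d * (d - 1) := by
  classical
  obtain ⟨p, hpc⟩ := CharP.exists K
  obtain ⟨n, hp, hn⟩ := FiniteField.card K p
  have : Fact p.Prime := ⟨hp⟩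
  obtain ⟨b, t, e, ht, hbt, he1, hep, h3, h2⟩ := LA_par p n hp.two_le n.2
  have hqq : Fintype.card K = p ^ b * p ^ t := by rw [hn, hbt, pow_add]
  rw [← hn] at h3 h2
  obtain ⟨l, m, hl, hls, hdim, hbd⟩ := LA_num2 (Fintype.card K) (p ^ b) e (p ^ t) d hd he1
    (Nat.one_le_pow _ _ hp.pos) hqq h3 h2 hq
  let T1 := T.filter (fun P => P.rep 2 = 0)
  let T2 := T.filter (fun P => eval P.rep (pderiv 0 F) = 0 ∧ eval P.rep (pderiv 1 F) = 0)
  let T3 := T.filter (fun P => P.rep 2 ≠ 0 ∧ (eval P.rep (pderiv 0 F) ≠ 0 ∨ eval P.rep (pderiv 1 F) ≠ 0))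
  have hsub : T ⊆ (T1 ∪ T2) ∪ T3 := by
    intro P hP
    simp only [Finset.mem_union, Finset.mem_filter, T1, T2, T3, hP, true_and]
    tauto
  have hcard : T.card ≤ T1.card + T2.card + T3.card :=
    (Finset.card_le_card hsub).trans ((Finset.card_union_le _ _).trans
      (Nat.add_le_add_right (Finset.card_union_le _ _) _))
  have c1 : T1.card ≤ 1 * d := by
    refine LA_bez1 hF hFi (isHomogeneous_X K 2) (X_ne_zero 2) (by omega) T1 ?_ ?_
    · intro P hP; exact hTF P (Finset.mem_filter.1 hP).1
    · intro P hP; simpa using (Finset.mem_filter.1 hP).2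
  have c2 : T2.card ≤ (d - 1) * d := by
    rcases LA_sing p (by omega) hF hFi with h | h
    · refine LA_bez1 hF hFi hF.pderiv h (by omega) T2 ?_ ?_
      · intro P hP; exact hTF P (Finset.mem_filter.1 hP).1
      · intro P hP; exact (Finset.mem_filter.1 hP).2.1
    · refine LA_bez1 hF hFi hF.pderiv h (by omega) T2 ?_ ?_
      · intro P hP; exact hTF P (Finset.mem_filter.1 hP).1
      · intro P hP; exact (Finset.mem_filter.1 hP).2.2
  have c3 := LA_stepanov p b t ht hqq (by omega) hF hFi.prime e hep l m hl hls
    (by push_cast at hdim; exact hdim) T3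
    (fun P hP => hTF P (Finset.mem_filter.1 hP).1) (fun P hP => (Finset.mem_filter.1 hP).2.1)
    (fun P hP => (Finset.mem_filter.1 hP).2.2)
  have c3' : ((e * T3.card : ℕ) : ℝ) ≤ (((l + m * p ^ t) * d : ℕ) : ℝ) := by exact_mod_cast c3
  have c4 := c3'.trans hbd
  rw [Nat.cast_mul] at c4
  have c5 := le_of_mul_le_mul_left c4 (by exact_mod_cast he1)
  have c6 : T.card ≤ d ^ 2 + T3.card := by
    have : 1 * d + (d - 1) * d = d ^ 2 := by
      obtain ⟨k, rfl⟩ := Nat.exists_eq_add_of_le' (show 1 ≤ d by omega)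
      simp; ring
    omega
  have c7 : (T.card : ℝ) ≤ d ^ 2 + T3.card := by exact_mod_cast c6
  linarith

theorem LA_final4 (N q d c s : ℝ) (hd : 4 ≤ d) (hc : 1.2 ≤ c) (hs : s ^ 2 = q)
    (hsd : c * d * (d - 1) * (d - 2) ≤ s) (hN : N ≤ q + c * s * d * (d - 1))
    (h : N ^ 2 + d * (q ^ 2 + q + 1) ≤ N * (1 + d * (q + 1))) : False := by
  obtain ⟨D, hD⟩ : ∃ D : ℝ, D = d * (d - 1) := ⟨_, rfl⟩
  have hD12 : 12 ≤ D := by rw [hD]; nlinarith only [hd]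
  have hDd : d ≤ D := by rw [hD]; nlinarith only [hd]
  obtain ⟨E, hE⟩ : ∃ E : ℝ, E = c * s * d * (d - 1) := ⟨_, rfl⟩
  have hED : E = c * D * s := by rw [hE, hD]; ring
  have hcD : 1.2 * D ≤ c * D := mul_le_mul_of_nonneg_right hc (by linarith)
  have hs1 : c * D * (d - 2) ≤ s := by rw [hD]; linarith
  have hs2 : c * D * 2 ≤ s := by
    refine le_trans ?_ hs1
    exact mul_le_mul_of_nonneg_left (by linarith) (by linarith)
  have hs0 : 0 < s := by linarith
  have hEd : (d - 2) * E ≤ q := by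
    have := mul_le_mul_of_nonneg_right hs1 hs0.le
    rw [hED, ← hs]; linarith
  have hE14 : 14 * s ≤ E := by
    rw [hED]; exact mul_le_mul_of_nonneg_right (by linarith) hs0.le
  have hE0 : 0 < E := by linarith
  have hq0 : 0 < q := by rw [← hs]; positivity
  rw [← hE] at hN
  have h1 : q + E + N ≤ 1 + d * (q + 1) := by
    have : 2 * E ≤ q := by
      have : 2 * E ≤ (d - 2) * E := mul_le_mul_of_nonneg_right (by linarith) hE0.le
      linarith
    have : 4 * (q + 1) ≤ d * (q + 1) := mul_le_mul_of_nonneg_right hd (by linarith)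
    linarith
  have h2 : 0 ≤ (q + E - N) * (1 + d * (q + 1) - (q + E + N)) :=
    mul_nonneg (by linarith) (by linarith)
  have h3 : s * s ≤ E * (E - d - 1) := mul_le_mul (by linarith) (by linarith) hs0.le hE0.le
  have h4 : q * ((d - 2) * E) ≤ q * q := mul_le_mul_of_nonneg_left hEd hq0.le
  nlinarith only [h, h2, h3, h4, hs, hd]

open scoped LinearAlgebra.Projectivization in
theorem line_avoiding_aux
    (F : Type) [Field F] [Fintype F]
    (P : MvPolynomial (Fin 3) F) (δ : ℕ) (hδ : 2 ≤ δ)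
    (hhom : P.IsHomogeneous δ)
    (hirr : Irreducible P)
    (hq : (Fintype.card F : ℝ) >
      ((1 + Real.sqrt 2) / 2) ^ 2 * (δ : ℝ) ^ 2 * ((δ : ℝ) - 1) ^ 2 * ((δ : ℝ) - 2) ^ 2) :
    ∃ ℓ : MvPolynomial (Fin 3) F, ℓ ≠ 0 ∧ ℓ.IsHomogeneous 1 ∧
      ∀ v : Fin 3 → F, v ≠ 0 → eval v ℓ = 0 → eval v P ≠ 0 := by
  classical
  by_contra hcon
  push Not at hcon
  have : Finite (ℙ F (Fin 3 → F)) := (Projectivization.finite_iff_of_finite F (Fin 3 → F)).2 inferInstance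
  have : Fintype (ℙ F (Fin 3 → F)) := Fintype.ofFinite _
  let B : Finset (ℙ F (Fin 3 → F)) := Finset.univ.filter (fun c => eval c.rep P = 0)
  let L : ℙ F (Fin 3 → F) → MvPolynomial (Fin 3) F := fun c => ∑ i, C (c.rep i) * X i
  have hL1 : ∀ c, (L c).IsHomogeneous 1 := fun c => by
    refine IsHomogeneous.sum _ _ _ fun i _ => ?_
    simpa using (isHomogeneous_C (Fin 3) (c.rep i)).mul (isHomogeneous_X F i)
  have hLe : ∀ c v, eval v (L c) = v ⬝ᵥ c.rep := fun c v => by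
    simp [L, dotProduct, map_sum, mul_comm]
  have hL0 : ∀ c, L c ≠ 0 := fun c h => by
    apply c.rep_nonzero
    funext i
    have := hLe c (Pi.single i 1)
    rw [h, map_zero, single_one_dotProduct] at this
    exact this.symm
  have horth : ∀ Q c : ℙ F (Fin 3 → F), Projectivization.orthogonal Q c ↔ Q.rep ⬝ᵥ c.rep = 0 := by
    intro Q c
    conv_lhs => rw [← Q.mk_rep, ← c.mk_rep]
    exact Projectivization.orthogonal_mk _ _
  have hcomb := LA_comb B δ
    (by
      intro c
      obtain ⟨v, hv, hvl, hvP⟩ := hcon (L c) (hL0 c) (hL1 c)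
      refine ⟨Projectivization.mk F v hv, ?_, ?_⟩
      · obtain ⟨a, ha⟩ := Projectivization.exists_smul_eq_mk_rep F v hv
        simp only [B, Finset.mem_filter, Finset.mem_univ, true_and]
        rw [← ha, Units.smul_def, LA_eval_smul hhom, hvP, mul_zero]
      · rw [hLe] at hvl
        conv => arg 2; rw [← c.mk_rep]
        exact (Projectivization.orthogonal_mk _ _).2 hvl)
    (by
      intro c T hT hTc
      have := LA_bez1 hhom hirr (hL1 c) (hL0 c) (by omega) T
        (fun Q hQ => (Finset.mem_filter.1 (hT hQ)).2)
        (fun Q hQ => by rw [hLe]; exact (horth _ _).1 (hTc Q hQ))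
      simpa using this)
  rcases Nat.lt_or_ge δ 4 with h4 | h4
  · have hq2 : 2 ≤ Fintype.card F := Fintype.one_lt_card
    have : δ = 2 ∨ δ = 3 := by omega
    rcases this with rfl | rfl
    · have hq2' : (2 : ℤ) ≤ Fintype.card F := by exact_mod_cast hq2
      push_cast at hcomb
      nlinarith only [hcomb, hq2', sq_nonneg (2 * (B.card : ℤ) - 2 * Fintype.card F - 3)]
    · have hq5 : (5 : ℝ) ≤ Fintype.card F := by
        have h1 := Real.sqrt_nonneg 2
        push_cast at hq
        nlinarith
      have hq5' : (5 : ℤ) ≤ Fintype.card F := by exact_mod_cast hq5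
      push_cast at hcomb
      nlinarith only [hcomb, hq5', sq_nonneg (2 * (B.card : ℤ) - 3 * Fintype.card F - 4)]
  · have hcount := LA_count h4 hhom hirr hq B (fun Q hQ => (Finset.mem_filter.1 hQ).2)
    have hs2a : 1.4142 ≤ Real.sqrt 2 := Real.le_sqrt_of_sq_le (by norm_num)
    refine LA_final4 B.card (Fintype.card F) δ ((1 + Real.sqrt 2) / 2) (Real.sqrt (Fintype.card F))
      (by exact_mod_cast h4) (by linarith) (Real.sq_sqrt (by positivity)) ?_ hcount
      (by exact_mod_cast hcomb)
    apply Real.le_sqrt_of_sq_le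
    refine le_trans (le_of_eq ?_) hq.le
    ring

/-- Remark 2.2: the conclusion of Proposition 2.1 continues to hold for plane curves that are
merely irreducible over `𝔽_q` (not necessarily geometrically irreducible). -/
theorem line_avoiding_rational_points_of_irreducible_curve
    (F : Type) [Field F] [Fintype F]
    (P : MvPolynomial (Fin 3) F) (δ : ℕ) (hδ : 2 ≤ δ)
    (hhom : P.IsHomogeneous δ)
    (hirr : Irreducible P)
    (hq : (Fintype.card F : ℝ) >
      ((1 + Real.sqrt 2) / 2) ^ 2 * (δ : ℝ) ^ 2 * ((δ : ℝ) - 1) ^ 2 * ((δ : ℝ) - 2) ^ 2) :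
    ∃ ℓ : MvPolynomial (Fin 3) F, ℓ ≠ 0 ∧ ℓ.IsHomogeneous 1 ∧
      ∀ v : Fin 3 → F, v ≠ 0 → eval v ℓ = 0 → eval v P ≠ 0 := by
  exact line_avoiding_aux F P δ hδ hhom hirr hq
end

section
/- Let 𝔽_q be a finite field with q elements, let V = 𝔽_q³, and let S be a finite set of points of the projective plane ℙ(V) (the projectivization of V). Let δ ≥ 1 be an integer, and suppose that every line of ℙ(V) (i.e., every 2-dimensional 𝔽_q-subspace of V) contains at most δ points of S. Then the number t₀ of lines L of ℙ(V) containing no point of S satisfies the inequality (as rational numbers): t₀ ≥ (q² + q + 1) − (q+1)·|S| + |S|·(|S| − 1)/δ. -/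
open scoped LinearAlgebra.Projectivization in
/-- Duality: points of the plane correspond to lines through the dot product. -/
lemma exists_dual_equiv (F : Type) [Field F] :
    ∃ e : ℙ F (Fin 3 → F) ≃ {L : Submodule F (Fin 3 → F) // Module.finrank F L = 2},
      ∀ P Q, Projectivization.submodule P ≤ (e Q).1 ↔ Projectivization.orthogonal P Q := by
  let B : LinearMap.BilinForm F (Fin 3 → F) := dotProductBilin F F
  have hB0 : B.IsRefl := by
    intro x y h
    change y ⬝ᵥ x = 0
    rw [dotProduct_comm]
    exact h
  have hB : B.Nondegenerate := by
    refine ⟨fun x h => ?_, fun x h => ?_⟩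
    · exact dotProduct_eq_zero_iff.1 h
    · refine dotProduct_eq_zero_iff.1 fun y => ?_
      rw [dotProduct_comm]
      exact h y
  have h3 : Module.finrank F (Fin 3 → F) = 3 := by simp
  let d : {H : Submodule F (Fin 3 → F) // Module.finrank F H = 1} ≃
      {L : Submodule F (Fin 3 → F) // Module.finrank F L = 2} :=
    { toFun := fun H => ⟨B.orthogonal H.1, by
        rw [LinearMap.BilinForm.finrank_orthogonal hB, h3, H.2]⟩
      invFun := fun H => ⟨B.orthogonal H.1, by
        rw [LinearMap.BilinForm.finrank_orthogonal hB, h3, H.2]⟩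
      left_inv := fun H => Subtype.ext
        (LinearMap.BilinForm.orthogonal_orthogonal hB hB0 H.1)
      right_inv := fun H => Subtype.ext
        (LinearMap.BilinForm.orthogonal_orthogonal hB hB0 H.1) }
  refine ⟨(Projectivization.equivSubmodule F _).trans d, fun P Q => ?_⟩
  change P.submodule ≤ B.orthogonal Q.submodule ↔ _
  induction P with | h v hv =>
  induction Q with | h w hw =>
  rw [Projectivization.submodule_mk, Projectivization.submodule_mk,
    Projectivization.orthogonal_mk, Submodule.span_singleton_le_iff_mem,
    LinearMap.BilinForm.mem_orthogonal_iff, dotProduct_comm]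
  constructor
  · intro h
    exact h w (Submodule.mem_span_singleton_self w)
  · intro h n hn
    obtain ⟨c, rfl⟩ := Submodule.mem_span_singleton.1 hn
    change (c • w) ⬝ᵥ v = 0
    rw [smul_dotProduct, h, smul_zero]

open scoped LinearAlgebra.Projectivization in
/-- The number of points is `q² + q + 1`. -/
lemma card_plane (F : Type) [Field F] [Fintype F] [Fintype (ℙ F (Fin 3 → F))] :
    Fintype.card (ℙ F (Fin 3 → F)) = Fintype.card F ^ 2 + Fintype.card F + 1 := by
  rw [← Nat.card_eq_fintype_card, Projectivization.card_of_finrank F (Fin 3 → F) (n := 3) (by simp),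
    Nat.card_eq_fintype_card]
  simp [Finset.sum_range_succ]
  ring

open scoped LinearAlgebra.Projectivization Classical in
/-- Two points lie on `q + 1` common lines if they agree, and on one otherwise. -/
lemma sum_incidence (F : Type) [Field F] [Fintype F] [Fintype (ℙ F (Fin 3 → F))]
    (P P' : ℙ F (Fin 3 → F)) :
    ∑ Q : ℙ F (Fin 3 → F), (if P.orthogonal Q then (1 : ℚ) else 0) *
      (if P'.orthogonal Q then (1 : ℚ) else 0) =
      (if P = P' then (Fintype.card F : ℚ) else 0) + 1 := by
  have hmul : ∀ Q : ℙ F (Fin 3 → F), (if P.orthogonal Q then (1 : ℚ) else 0) *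
      (if P'.orthogonal Q then (1 : ℚ) else 0) =
      if P.orthogonal Q ∧ P'.orthogonal Q then 1 else 0 := by
    intro Q
    by_cases h : P.orthogonal Q <;> by_cases h' : P'.orthogonal Q <;> simp [h, h']
  simp_rw [hmul]
  rw [Finset.sum_boole]
  by_cases h : P = P'
  · subst h
    simp only [and_self, if_true]
    have h1 := Configuration.ProjectivePlane.lineCount_eq (ℙ F (Fin 3 → F)) P
    have h2 := Configuration.ProjectivePlane.card_points (ℙ F (Fin 3 → F)) (ℙ F (Fin 3 → F))
    rw [card_plane] at h2
    have h3 : Configuration.ProjectivePlane.order (ℙ F (Fin 3 → F)) (ℙ F (Fin 3 → F))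
        = Fintype.card F := by nlinarith
    rw [h3, Configuration.lineCount, Nat.card_eq_fintype_card, Fintype.card_subtype] at h1
    have h4 : (Finset.univ.filter fun Q => P.orthogonal Q).card = Fintype.card F + 1 := h1
    rw [h4]
    push_cast
    rfl
  · rw [if_neg h]
    have : (Finset.univ.filter fun Q => P.orthogonal Q ∧ P'.orthogonal Q) =
        {Projectivization.cross P P'} := by
      ext Q
      simp only [Finset.mem_filter, Finset.mem_univ, true_and, Finset.mem_singleton]
      constructor
      · rintro ⟨h1, h2⟩
        exact (Configuration.ofField.eq_or_eq_of_orthogonal h1 h2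
          (Projectivization.orthogonal_cross_left h)
          (Projectivization.orthogonal_cross_right h)).resolve_left h
      · rintro rfl
        exact ⟨Projectivization.orthogonal_cross_left h,
          Projectivization.orthogonal_cross_right h⟩
    rw [this]
    simp


/-- Inequality (2.6) in the proof of Proposition 2.1: if every line of `ℙ²(𝔽_q)` contains at
most `δ` points of a set `S`, then the number `t₀` of lines containing no point of `S`
satisfies `t₀ ≥ (q² + q + 1) − (q+1)|S| + |S|(|S|−1)/δ`. -/
theorem lower_bound_on_lines_avoiding_point_set
    (F : Type) [Field F] [Fintype F]
    (S : Finset (Projectivization F (Fin 3 → F))) (δ : ℕ) (hδ : 1 ≤ δ)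
    (hline : ∀ L : Submodule F (Fin 3 → F), Module.finrank F L = 2 →
      Nat.card {P : Projectivization F (Fin 3 → F) // P ∈ S ∧ P.submodule ≤ L} ≤ δ) :
    (Nat.card {L : Submodule F (Fin 3 → F) //
        Module.finrank F L = 2 ∧ ∀ P ∈ S, ¬ Projectivization.submodule P ≤ L} : ℚ) ≥
      ((Fintype.card F : ℚ) ^ 2 + (Fintype.card F : ℚ) + 1)
        - ((Fintype.card F : ℚ) + 1) * (S.card : ℚ)
        + (S.card : ℚ) * ((S.card : ℚ) - 1) / (δ : ℚ) := by

  classical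
  haveI : Fintype (Projectivization F (Fin 3 → F)) := Fintype.ofFinite _
  obtain ⟨e, he⟩ := exists_dual_equiv F
  let a : Projectivization F (Fin 3 → F) → Projectivization F (Fin 3 → F) → ℚ :=
    fun P Q => if P.orthogonal Q then 1 else 0
  let m : Projectivization F (Fin 3 → F) → ℕ := fun Q => (S.filter fun P => P.orthogonal Q).card
  have hm : ∀ Q, (m Q : ℚ) = ∑ P ∈ S, a P Q := fun Q => by
    simp only [m, a, Finset.sum_boole]
  have hmδ : ∀ Q, m Q ≤ δ := fun Q => by
    have h := hline (e Q).1 (e Q).2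
    simp only [he] at h
    rwa [Nat.subtype_card (S.filter fun P => P.orthogonal Q) (by simp)] at h
  have ht : (Nat.card {L : Submodule F (Fin 3 → F) //
        Module.finrank F L = 2 ∧ ∀ P ∈ S, ¬ Projectivization.submodule P ≤ L}) =
      (Finset.univ.filter fun Q => m Q = 0).card := by
    rw [← Nat.subtype_card (p := fun Q => m Q = 0) (Finset.univ.filter fun Q => m Q = 0) (by simp)]
    refine Nat.card_congr ((Equiv.subtypeSubtypeEquivSubtypeInter _ _).symm.trans
      (e.subtypeEquiv fun Q => ?_).symm)
    simp only [he, m, Finset.card_eq_zero, Finset.filter_eq_empty_iff]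
  have hs1 : ∑ Q, (m Q : ℚ) = (S.card : ℚ) * ((Fintype.card F : ℚ) + 1) := by
    simp_rw [hm]
    rw [Finset.sum_comm]
    have : ∀ P ∈ S, ∑ Q, a P Q = (Fintype.card F : ℚ) + 1 := fun P _ => by
      have h := sum_incidence F P P
      rw [if_pos rfl] at h
      rw [← h]
      refine Finset.sum_congr rfl fun Q _ => ?_
      simp only [a]
      split_ifs <;> simp
    rw [Finset.sum_congr rfl this, Finset.sum_const, nsmul_eq_mul]
  have hs2 : ∑ Q, (m Q : ℚ) * (m Q : ℚ) =
      (S.card : ℚ) * (Fintype.card F : ℚ) + (S.card : ℚ) * (S.card : ℚ) := by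
    simp_rw [hm, Finset.sum_mul_sum]
    rw [Finset.sum_comm]
    have : ∀ P ∈ S, ∑ Q, ∑ P' ∈ S, a P Q * a P' Q = (Fintype.card F : ℚ) + S.card := by
      intro P hP
      rw [Finset.sum_comm]
      rw [Finset.sum_congr rfl fun P' _ => sum_incidence F P P']
      rw [Finset.sum_add_distrib, Finset.sum_ite_eq, if_pos hP]
      simp
    rw [Finset.sum_congr rfl this, Finset.sum_const, nsmul_eq_mul, mul_add]
  have hδ' : (0 : ℚ) < δ := by exact_mod_cast hδ
  have hpt : ∀ Q, (1 : ℚ) - m Q + ((m Q : ℚ) * m Q - m Q) / δ ≤ if m Q = 0 then 1 else 0 := by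
    intro Q
    split_ifs with h
    · simp [h]
    · have h1 : (1 : ℚ) ≤ m Q := by exact_mod_cast Nat.one_le_iff_ne_zero.2 h
      have h2 : (m Q : ℚ) ≤ δ := by exact_mod_cast hmδ Q
      have h3 : ((m Q : ℚ) * m Q - m Q) / δ ≤ m Q - 1 := by
        rw [div_le_iff₀ hδ']
        nlinarith
      linarith
  have hsum := Finset.sum_le_sum fun Q (_ : Q ∈ Finset.univ) => hpt Q
  rw [Finset.sum_boole, Finset.sum_add_distrib, ← Finset.sum_div, Finset.sum_sub_distrib,
    Finset.sum_sub_distrib, hs1, hs2, Finset.sum_const, Finset.card_univ, card_plane,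
    nsmul_eq_mul] at hsum
  rw [ht]
  push_cast at hsum
  refine le_trans (le_of_eq ?_) hsum
  ring
end

section
/- Let 𝔽_q be a finite field with q elements, where q is odd. Then there exists an element c ∈ 𝔽_q such that c² − 2c + 5 is not a square in 𝔽_q. -/
/-- Corollary 3.2: in a finite field of odd order, there is an element `c` such that
`c² − 2c + 5` is a non-square. -/
theorem exists_c_with_nonsquare_discriminant
    (F : Type) [Field F] [Fintype F] (hodd : Odd (Fintype.card F)) :
    ∃ c : F, ¬ ∃ b : F, c ^ 2 - 2 * c + 5 = b ^ 2 := by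
  by_contra! H
  have hchar : ringChar F ≠ 2 := by
    intro h
    have := FiniteField.even_card_of_char_two h
    rw [Nat.odd_iff] at hodd
    omega
  have h2 : (2 : F) ≠ 0 := Ring.two_ne_zero hchar
  -- squares are closed under addition
  have key : ∀ x y : F, ∃ b : F, x ^ 2 + y ^ 2 = b ^ 2 := by
    intro x y
    by_cases hy : y = 0
    · exact ⟨x, by simp [hy]⟩
    obtain ⟨b, hb⟩ := H (2 * x / y + 1)
    refine ⟨y / 2 * b, ?_⟩
    rw [mul_pow, ← hb]
    field_simp
    ring
  have hnat : ∀ n : ℕ, ∃ b : F, (n : F) = b ^ 2 := by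
    intro n
    induction n with
    | zero => exact ⟨0, by simp⟩
    | succ k ih =>
      obtain ⟨b, hb⟩ := ih
      obtain ⟨d, hd⟩ := key b 1
      exact ⟨d, by rw [← hd, ← hb]; push_cast; ring⟩
  obtain ⟨i, hi⟩ := hnat (Fintype.card F - 1)
  rw [Nat.cast_sub Fintype.card_pos, FiniteField.cast_card_eq_zero] at hi
  obtain ⟨a, ha⟩ := FiniteField.exists_nonsquare hchar
  apply ha
  obtain ⟨b, hb⟩ := key ((a + 1) / 2) (i * ((a - 1) / 2))
  refine ⟨b, ?_⟩
  rw [← pow_two, ← hb, mul_pow, ← hi]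
  field_simp
  push_cast
  ring
end

section
/- Let 𝔽_q be a finite field with q elements, where q is odd, and let c ∈ 𝔽_q be such that c² − 2c + 5 is not a square in 𝔽_q. Define the homogeneous quadratic polynomials f₀ = x² + y² + z² + w² and f₁ = xy + yz + zw + c·wx in 𝔽_q[x,y,z,w]. Then for every pair (s,t) ∈ 𝔽_q² with (s,t) ≠ (0,0), the quadric surface defined by h = s·f₀ + t·f₁ = 0 in ℙ³ is smooth; that is, there is no nonzero point v ∈ K⁴, where K is an algebraic closure of 𝔽_q, at which h and all four formal partial derivatives of h vanish simultaneously. -/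
open MvPolynomial

/-- Proposition 3.3: for odd `q` and `c ∈ 𝔽_q` with `c² − 2c + 5` a non-square, every
`𝔽_q`-member of the pencil spanned by `x² + y² + z² + w²` and `xy + yz + zw + c·wx`
is a smooth quadric surface in `ℙ³`. -/
theorem pencil_of_smooth_quadrics_odd_char
    (F : Type) [Field F] [Fintype F] (hodd : Odd (Fintype.card F))
    (c : F) (hc : ¬ ∃ b : F, c ^ 2 - 2 * c + 5 = b ^ 2)
    (f₀ f₁ : MvPolynomial (Fin 4) F)
    (hf₀ : f₀ = X 0 ^ 2 + X 1 ^ 2 + X 2 ^ 2 + X 3 ^ 2)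
    (hf₁ : f₁ = X 0 * X 1 + X 1 * X 2 + X 2 * X 3 + C c * (X 3 * X 0)) :
    ∀ s t : F, (s, t) ≠ (0, 0) →
      ∀ v : Fin 4 → AlgebraicClosure F, v ≠ 0 →
        ¬ (eval v (map (algebraMap F (AlgebraicClosure F)) (C s * f₀ + C t * f₁)) = 0 ∧
          ∀ i : Fin 4,
            eval v (map (algebraMap F (AlgebraicClosure F))
              (pderiv i (C s * f₀ + C t * f₁))) = 0) := by
  subst hf₀ hf₁
  intro s t hst v hv ⟨_, hd⟩
  have h2 : (2 : F) ≠ 0 := by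
    intro h
    have := FiniteField.even_card_iff_char_two (F := F)
    have h3 : ringChar F = 2 := by
      have hdvd : ringChar F ∣ 2 := by
        exact ringChar.dvd (by exact_mod_cast h)
      rcases (Nat.dvd_prime Nat.prime_two).1 hdvd with h1 | h1
      · exact absurd h1 CharP.ringChar_ne_one
      · exact h1
    rw [this, ← Nat.even_iff] at h3
    exact (Nat.not_even_iff_odd.2 hodd) h3
  -- the nonvanishing of the determinant
  have hD : ((2 * s) ^ 2 - t ^ 2 * (1 + c ^ 2)) * ((2 * s) ^ 2 - 2 * t ^ 2)
      - t ^ 4 * (1 + c) ^ 2 ≠ 0 := by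
    intro hD
    by_cases ht : t = 0
    · subst ht
      have h16 : (2 * s) ^ 4 = 0 := by linear_combination hD
      have hs : s = 0 := by simpa [h2] using h16
      exact hst (by rw [hs])
    · by_cases hc1 : c + 1 = 0
      · have hce : c = -1 := by linear_combination hc1
        subst hce
        have h0 : ((2 * s) ^ 2 - 2 * t ^ 2) ^ 2 = 0 := by linear_combination hD
        have h1 : (2 * s) ^ 2 - 2 * t ^ 2 = 0 := by simpa using h0
        apply hc
        refine ⟨4 * s / t, ?_⟩
        field_simp
        linear_combination (-4) * h1
      · apply hc
        refine ⟨(2 * (2 * s) ^ 2 - t ^ 2 * (3 + c ^ 2)) / (t ^ 2 * (c + 1)), ?_⟩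
        field_simp
        linear_combination (-4) * hD
  have e0 := hd 0
  have e1 := hd 1
  have e2 := hd 2
  have e3 := hd 3
  simp [pderiv_X] at e0 e1 e2 e3
  have hDK := (map_ne_zero (algebraMap F (AlgebraicClosure F))).2 hD
  simp only [map_sub, map_mul, map_pow, map_add, map_ofNat, map_one] at hDK
  generalize algebraMap F (AlgebraicClosure F) s = S at *
  generalize algebraMap F (AlgebraicClosure F) t = T at *
  generalize algebraMap F (AlgebraicClosure F) c = k at *
  have a0 : ((2 * S) ^ 2 - T ^ 2 * (1 + k ^ 2)) * v 0 = T ^ 2 * (1 + k) * v 2 := by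
    linear_combination (2 * S) * e0 - T * e1 - T * k * e3
  have a2 : ((2 * S) ^ 2 - 2 * T ^ 2) * v 2 = T ^ 2 * (1 + k) * v 0 := by
    linear_combination (2 * S) * e2 - T * e1 - T * e3
  have a1 : ((2 * S) ^ 2 - 2 * T ^ 2) * v 1 = T ^ 2 * (1 + k) * v 3 := by
    linear_combination (2 * S) * e1 - T * e0 - T * e2
  have a3 : ((2 * S) ^ 2 - T ^ 2 * (1 + k ^ 2)) * v 3 = T ^ 2 * (1 + k) * v 1 := by
    linear_combination (2 * S) * e3 - T * k * e0 - T * e2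
  apply hv
  funext i
  apply (mul_eq_zero.1 (?_ : _ * v i = 0)).resolve_left hDK
  fin_cases i
  · show _ * v 0 = 0
    linear_combination ((2 * S) ^ 2 - 2 * T ^ 2) * a0 + T ^ 2 * (1 + k) * a2
  · show _ * v 1 = 0
    linear_combination ((2 * S) ^ 2 - T ^ 2 * (1 + k ^ 2)) * a1 + T ^ 2 * (1 + k) * a3
  · show _ * v 2 = 0
    linear_combination ((2 * S) ^ 2 - T ^ 2 * (1 + k ^ 2)) * a2 + T ^ 2 * (1 + k) * a0
  · show _ * v 3 = 0
    linear_combination ((2 * S) ^ 2 - 2 * T ^ 2) * a3 + T ^ 2 * (1 + k) * a1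
end

section
/- Let 𝔽_q be a finite field with q elements, where q is even (characteristic 2), and let c ∈ 𝔽_q be such that the polynomial t² + t + c is irreducible in 𝔽_q[t]. Define the homogeneous quadratic polynomials f₀ = x² + y² + xy + yz + c·zw and f₁ = x² + z² + yz + xw in 𝔽_q[x,y,z,w]. Then for every pair (s,t) ∈ 𝔽_q² with (s,t) ≠ (0,0), the quadric surface defined by h = s·f₀ + t·f₁ = 0 in ℙ³ is smooth; that is, there is no nonzero point v ∈ K⁴, where K is an algebraic closure of 𝔽_q, at which h and all four formal partial derivatives of h vanish simultaneously. -/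
open MvPolynomial

/-- Proposition 3.5: for even `q` and `c ∈ 𝔽_q` with `t² + t + c` irreducible, every
`𝔽_q`-member of the pencil spanned by `x² + y² + xy + yz + c·zw` and `x² + z² + yz + xw`
is a smooth quadric surface in `ℙ³`. -/
theorem pencil_of_smooth_quadrics_even_char
    (F : Type) [Field F] [Fintype F] (heven : Even (Fintype.card F))
    (c : F) (hc : Irreducible (Polynomial.X ^ 2 + Polynomial.X + Polynomial.C c))
    (f₀ f₁ : MvPolynomial (Fin 4) F)
    (hf₀ : f₀ = X 0 ^ 2 + X 1 ^ 2 + X 0 * X 1 + X 1 * X 2 + C c * (X 2 * X 3))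
    (hf₁ : f₁ = X 0 ^ 2 + X 2 ^ 2 + X 1 * X 2 + X 0 * X 3) :
    ∀ s t : F, (s, t) ≠ (0, 0) →
      ∀ v : Fin 4 → AlgebraicClosure F, v ≠ 0 →
        ¬ (eval v (map (algebraMap F (AlgebraicClosure F)) (C s * f₀ + C t * f₁)) = 0 ∧
          ∀ i : Fin 4,
            eval v (map (algebraMap F (AlgebraicClosure F))
              (pderiv i (C s * f₀ + C t * f₁))) = 0) := by
  intro s t hst v hv ⟨_, hd⟩
  have h2F : (2 : F) = 0 := by
    obtain ⟨k, hk⟩ := heven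
    have h := FiniteField.cast_card_eq_zero F
    rw [hk] at h
    push_cast at h
    have h4 : (2 : F) * k = 0 := by linear_combination h
    by_contra h2
    have hchar : ringChar F ≠ 2 := by
      intro h'
      apply h2
      have := ringChar.Nat.cast_ringChar (R := F)
      rw [h'] at this
      exact_mod_cast this
    have := FiniteField.odd_card_of_char_ne_two hchar
    omega
  have hP : t * (s + t) - c * s ^ 2 ≠ 0 := by
    intro h
    by_cases hs : s = 0
    · subst hs
      apply hst
      have : t = 0 := by simpa using h
      rw [this]
    · have hroot : Polynomial.IsRoot
          (Polynomial.X ^ 2 + Polynomial.X + Polynomial.C c : Polynomial F) (t / s) := by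
        simp only [Polynomial.IsRoot.def, Polynomial.eval_add, Polynomial.eval_pow,
          Polynomial.eval_X, Polynomial.eval_C]
        field_simp
        linear_combination h + c * s ^ 2 * h2F
      have h1 := Polynomial.degree_eq_one_of_irreducible_of_root hc hroot
      have h3 : (Polynomial.X ^ 2 + Polynomial.X + Polynomial.C c : Polynomial F).degree = 2 := by
        compute_degree!
      rw [h3] at h1
      exact absurd h1 (by decide)
  have h2 : (2 : AlgebraicClosure F) = 0 := by
    have := congrArg (algebraMap F (AlgebraicClosure F)) h2F
    rwa [map_ofNat, map_zero] at this
  have hP' := (map_ne_zero (algebraMap F (AlgebraicClosure F))).2 hP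
  simp only [map_add, map_sub, map_mul, map_pow] at hP'
  have e0 := hd 0
  have e1 := hd 1
  have e2 := hd 2
  have e3 := hd 3
  simp [hf₀, hf₁, pderiv_X, Pi.single_apply, Derivation.leibniz_pow, h2] at e0 e1 e2 e3
  generalize algebraMap F (AlgebraicClosure F) s = S at *
  generalize algebraMap F (AlgebraicClosure F) t = T at *
  generalize algebraMap F (AlgebraicClosure F) c = Γ at *
  apply hv
  have k3 : v 3 = 0 := by
    refine (mul_eq_zero.1 ?_).resolve_left hP'
    linear_combination (S + T) * e0 - S * e2
  have k1 : v 1 = 0 := by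
    refine (mul_eq_zero.1 ?_).resolve_left hP'
    linear_combination T * e2 - Γ * S * e0
  have k2 : v 2 = 0 := by
    refine (mul_eq_zero.1 ?_).resolve_left hP'
    linear_combination T * e1 - S * e3
  have k0 : v 0 = 0 := by
    refine (mul_eq_zero.1 ?_).resolve_left hP'
    linear_combination (S + T) * e3 - Γ * S * e1
  funext i
  fin_cases i <;> simp [k0, k1, k2, k3]
end

section
/- Let 𝔽_q be any finite field with q elements. Then there exist homogeneous polynomials f₀, f₁ of degree 2 in 𝔽_q[x,y,z,w], linearly independent over 𝔽_q, such that for every pair (s,t) ∈ 𝔽_q² with (s,t) ≠ (0,0), the quadric surface defined by s·f₀ + t·f₁ = 0 in ℙ³ is smooth; that is, there is no nonzero point v ∈ K⁴, where K is an algebraic closure of 𝔽_q, at which s·f₀ + t·f₁ and all four of its formal partial derivatives vanish simultaneously. -/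
open MvPolynomial

theorem aux_exists_c (F : Type) [Field F] [Fintype F] :
    ∃ c : F, ∀ s t : F, (s, t) ≠ (0, 0) → s * (s - t) - t * c * t ≠ 0 := by
  have hni : ¬ Function.Injective (fun x : F => x * x - x) := by
    intro h
    have := @h 0 1 (by simp)
    exact zero_ne_one this
  rw [Finite.injective_iff_surjective] at hni
  simp only [Function.Surjective, not_forall, not_exists] at hni
  obtain ⟨c, hc⟩ := hni
  refine ⟨c, fun s t hst h => ?_⟩
  by_cases ht : t = 0
  · subst ht
    apply hst
    have : s = 0 := by simpa using h
    simp [this]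
  · apply hc (s / t)
    field_simp
    linear_combination h

/-- Section 3: over every finite field `𝔽_q` there is a pencil of quadric surfaces in `ℙ³`
all of whose `𝔽_q`-members are smooth. -/
theorem pencil_of_smooth_quadric_surfaces_exists
    (F : Type) [Field F] [Fintype F] :
    ∃ f₀ f₁ : MvPolynomial (Fin 4) F,
      f₀.IsHomogeneous 2 ∧ f₁.IsHomogeneous 2 ∧
      LinearIndependent F ![f₀, f₁] ∧
      ∀ s t : F, (s, t) ≠ (0, 0) →
        ∀ v : Fin 4 → AlgebraicClosure F, v ≠ 0 →
          ¬ (eval v (map (algebraMap F (AlgebraicClosure F)) (C s * f₀ + C t * f₁)) = 0 ∧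
            ∀ i : Fin 4,
              eval v (map (algebraMap F (AlgebraicClosure F))
                (pderiv i (C s * f₀ + C t * f₁))) = 0) := by
  obtain ⟨c, hc⟩ := aux_exists_c F
  have hX : ∀ i j : Fin 4, (X i * X j : MvPolynomial (Fin 4) F).IsHomogeneous 2 :=
    fun i j => (isHomogeneous_X F i).mul (isHomogeneous_X F j)
  refine ⟨X 0 * X 2 + X 1 * X 3, C c * (X 0 * X 3) + X 1 * X 2 - X 1 * X 3,
    (hX _ _).add (hX _ _), (((hX _ _).C_mul c).add (hX _ _)).sub (hX _ _), ?_, ?_⟩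
  · rw [LinearIndependent.pair_iff]
    intro s t h
    have h1 := congrArg (eval ![1, 0, 1, 0]) h
    have h2 := congrArg (eval ![0, 1, 1, 0]) h
    simp [smul_eval] at h1 h2
    exact ⟨h1, h2⟩
  · rintro s t hst v hv ⟨-, h⟩
    apply hv
    have hd := hc s t hst
    have hd' : algebraMap F (AlgebraicClosure F) (s * (s - t) - t * c * t) ≠ 0 := by
      simpa only [ne_eq, FaithfulSMul.algebraMap_eq_zero_iff] using hd
    simp only [map_sub, map_mul] at hd'
    have h0 := h 0
    have h1 := h 1
    have h2 := h 2
    have h3 := h 3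
    simp [pderiv_X] at h0 h1 h2 h3
    generalize algebraMap F (AlgebraicClosure F) s = S at *
    generalize algebraMap F (AlgebraicClosure F) t = T at *
    generalize algebraMap F (AlgebraicClosure F) c = c' at *
    funext i
    apply (mul_eq_zero.mp (?_ : (S * (S - T) - T * c' * T) * v i = 0)).resolve_left hd'
    fin_cases i <;> simp [-mul_eq_zero]
    · linear_combination (S - T) * h2 - T * h3
    · linear_combination S * h3 - T * c' * h2
    · linear_combination (S - T) * h0 - T * c' * h1
    · linear_combination S * h1 - T * h0
end

section
/- Over the field 𝔽₂ with two elements, define f₀ = x² + y² + xz, f₁ = xy + xz + z², and f₂ = x² + yz in 𝔽₂[x,y,z]. Then for every triple (a₀, a₁, a₂) ∈ 𝔽₂³ with (a₀, a₁, a₂) ≠ (0,0,0), the conic defined by h = a₀f₀ + a₁f₁ + a₂f₂ = 0 in ℙ² is smooth; that is, there is no nonzero point v ∈ K³, where K is an algebraic closure of 𝔽₂, at which h and all three formal partial derivatives of h vanish simultaneously. -/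
open MvPolynomial

/-- Example 1.6: over `𝔽₂`, every nonzero `𝔽₂`-combination of the three conics
`x² + y² + xz`, `xy + xz + z²`, `x² + yz` is a smooth conic in `ℙ²`. -/
theorem net_of_smooth_conics_over_F2
    (f₀ f₁ f₂ : MvPolynomial (Fin 3) (ZMod 2))
    (hf₀ : f₀ = X 0 ^ 2 + X 1 ^ 2 + X 0 * X 2)
    (hf₁ : f₁ = X 0 * X 1 + X 0 * X 2 + X 2 ^ 2)
    (hf₂ : f₂ = X 0 ^ 2 + X 1 * X 2) :
    ∀ a₀ a₁ a₂ : ZMod 2, (a₀, a₁, a₂) ≠ (0, 0, 0) →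
      ∀ v : Fin 3 → AlgebraicClosure (ZMod 2), v ≠ 0 →
        ¬ (eval v (map (algebraMap (ZMod 2) (AlgebraicClosure (ZMod 2)))
              (C a₀ * f₀ + C a₁ * f₁ + C a₂ * f₂)) = 0 ∧
          ∀ i : Fin 3,
            eval v (map (algebraMap (ZMod 2) (AlgebraicClosure (ZMod 2)))
              (pderiv i (C a₀ * f₀ + C a₁ * f₁ + C a₂ * f₂))) = 0) := by
  intro a₀ a₁ a₂ ha v hv h
  obtain ⟨h, hd⟩ := h
  have hx := hd 0
  have hy := hd 1
  have hz := hd 2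
  have h2 : (2 : AlgebraicClosure (ZMod 2)) = 0 := CharTwo.two_eq_zero
  have hne : ¬ (v 0 = 0 ∧ v 1 = 0 ∧ v 2 = 0) := by
    rintro ⟨h0, h1, h3⟩
    apply hv
    funext i
    fin_cases i <;> assumption
  subst hf₀ hf₁ hf₂
  clear hd hv
  have key : ∀ a : ZMod 2, a = 0 ∨ a = 1 := by decide
  apply hne
  rcases key a₀ with rfl | rfl <;> rcases key a₁ with rfl | rfl <;>
    rcases key a₂ with rfl | rfl <;>
    simp [pderiv_X, Pi.single_apply, Derivation.leibniz, Derivation.leibniz_pow] at h hx hy hz ha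
  all_goals grind
end
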